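/- arXiv:2603.29381 — 7 statements merged into one kernel-verified Lean document; each statement's English description precedes it below -/
import Mathlib

section
/- Let G be a finite connected simple graph, let a and b be two distinct vertices of G, and let V_a and V_b be two nonempty vertex sets such that every v ∈ V_a ∪ V_b satisfies {a,b} ⊆ N_G(v). Let T be a spanning tree of G such that V_a ⊆ N_T(a), V_b ⊆ N_T(b), and the unique a–b path P^T_{a,b} in T contains no vertex of V_a ∪ V_b. Let T_1 be obtained from T by deleting the edges {bv : v ∈ V_b} and adding the edges {av : v ∈ V_b}, and let T_2 be obtained from T by deleting the edges {av : v ∈ V_a} and adding the edges {bv : v ∈ V_a}. Then T_1 and T_2 are spanning trees of G and min(W(T_1), W(T_2)) < W(T). -/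
open SimpleGraph

/-- The Wiener index of a graph: the sum of distances over all unordered pairs of
vertices (each unordered pair is counted twice in the double sum, hence the division). -/
noncomputable def wiener {V : Type*} [Fintype V] (G : SimpleGraph V) : ℕ :=
  (∑ u : V, ∑ v : V, G.dist u v) / 2

/-- `T` is a spanning tree of `G`. -/
def IsSpanningTree {V : Type*} (G T : SimpleGraph V) : Prop :=
  T ≤ G ∧ T.IsTree

/-- In a subgraph of a tree, distances between reachable vertices are the tree distances. -/
lemma dist_sub_eq {V : Type*} {T T' : SimpleGraph V} (hT : T.IsTree) (hle : T' ≤ T) {x y : V}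
    (h : T'.Reachable x y) : T'.dist x y = T.dist x y := by
  obtain ⟨p, hp, hpl⟩ := h.exists_path_of_dist
  obtain ⟨q, hq, hql⟩ := hT.connected.exists_path_of_dist x y
  have := (hT.existsUnique_path x y).unique (hp.mapLe hle) hq
  rw [← hpl, ← hql, ← this]
  simp [Walk.mapLe]

lemma reach_of_avoid {V : Type*} {T : SimpleGraph V} {b : V} {Vb : Set V} {x y : V}
    (p : T.Walk x y) (hb : b ∉ p.support) :
    ∃ q : (T.deleteEdges {e | ∃ v ∈ Vb, e = s(b, v)}).Walk x y, q.length = p.length := by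
  refine ⟨p.toDeleteEdges _ ?_, ?_⟩
  · rintro e he ⟨v, hv, rfl⟩
    exact hb (p.fst_mem_support_of_mem_edges he)
  · simp [Walk.toDeleteEdges]

lemma dist_split {V : Type*} {T : SimpleGraph V} (hT : T.IsTree) {b : V} {Vb : Set V} {x y : V}
    (h : ¬ (T.deleteEdges {e | ∃ v ∈ Vb, e = s(b, v)}).Reachable x y) :
    T.dist x y = T.dist x b + T.dist b y := by
  classical
  apply le_antisymm hT.connected.dist_triangle
  obtain ⟨p, hp⟩ := hT.connected.exists_walk_length_eq_dist x y
  by_cases hb : b ∈ p.support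
  · have h1 := congrArg Walk.length (p.take_spec hb)
    rw [Walk.length_append] at h1
    have h2 := dist_le (p.takeUntil b hb)
    have h3 := dist_le (p.dropUntil b hb)
    omega
  · obtain ⟨q, -⟩ := reach_of_avoid (Vb := Vb) p hb
    exact absurd ⟨q⟩ h

lemma key {V : Type*} [Fintype V] (T : SimpleGraph V) (hT : T.IsTree) (a b : V) (hab : a ≠ b)
    (Vb : Set V) (hVb : Vb.Nonempty) (hVbT : Vb ⊆ T.neighborSet b)
    (hpath : ∀ p : T.Walk a b, p.IsPath → ∀ v ∈ Vb, v ∉ p.support)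
    (T1 : SimpleGraph V)
    (hT1 : T1 = SimpleGraph.fromEdgeSet
      ((T.edgeSet \ {e | ∃ v ∈ Vb, e = s(b, v)}) ∪ {e | ∃ v ∈ Vb, e = s(a, v)})) :
    T1.IsTree ∧ ∃ B : V → Prop, (∃ x, B x) ∧ (∀ x, B x → T.dist a x = T.dist a b + T.dist b x) ∧
      (∀ x y, B x → ¬ B y → (T1.dist x y : ℤ) ≤ T.dist x y + (T.dist a y - T.dist b y)) ∧
      (∀ x y, (B x ↔ B y) → T1.dist x y ≤ T.dist x y) := by
  set S : Set (Sym2 V) := {e | ∃ v ∈ Vb, e = s(b, v)} with hS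
  set T' := T.deleteEdges S with hT'
  have hle : T' ≤ T := deleteEdges_le S
  have hle1 : T' ≤ T1 := by
    intro x y hxy
    rw [hT', deleteEdges_adj] at hxy
    rw [hT1, fromEdgeSet_adj]
    exact ⟨Or.inl ⟨hxy.1, hxy.2⟩, hxy.1.ne⟩
  have hra : T'.Reachable a b := by
    obtain ⟨p, hp, -⟩ := hT.connected.exists_path_of_dist a b
    refine ⟨p.toDeleteEdges _ ?_⟩
    rintro e he ⟨v, hv, rfl⟩
    exact hpath p hp v hv (p.snd_mem_support_of_mem_edges he)
  have hanot : a ∉ Vb := by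
    intro h
    obtain ⟨p, hp, -⟩ := hT.connected.exists_path_of_dist a b
    exact hpath p hp a h p.start_mem_support
  have hadj1 : ∀ w ∈ Vb, T1.Adj w a := by
    intro w hw
    rw [hT1, fromEdgeSet_adj]
    exact ⟨Or.inr ⟨w, hw, Sym2.eq_swap⟩, fun h => hanot (h ▸ hw)⟩
  -- walks out of B
  have hout : ∀ x, ¬ T'.Reachable b x → ∃ w : T1.Walk x a, w.length ≤ T.dist b x := by
    intro x hx
    obtain ⟨p, hp, hpl⟩ := hT.connected.exists_path_of_dist b x
    cases p with
    | nil => exact absurd (Reachable.refl _) hx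
    | @cons _ w _ h q =>
      rw [Walk.cons_isPath_iff] at hp
      obtain ⟨r, hr⟩ := reach_of_avoid (Vb := Vb) q hp.2
      have hw : w ∈ Vb := by
        by_contra hw
        apply hx
        have : T'.Adj b w := by
          rw [hT', deleteEdges_adj]
          refine ⟨h, ?_⟩
          rintro ⟨v, hv, he⟩
          rw [Sym2.congr_right] at he
          exact hw (he ▸ hv)
        exact this.reachable.trans ⟨r⟩
      refine ⟨((r.mapLe hle1).reverse).concat (hadj1 w hw), ?_⟩
      rw [Walk.length_cons] at hpl
      simp [Walk.mapLe]
      omega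
  have hconn : T1.Connected := by
    have hreach : ∀ x, T1.Reachable x a := by
      intro x
      by_cases hx : T'.Reachable b x
      · exact ((hra.trans hx).mono hle1).symm
      · obtain ⟨w, -⟩ := hout x hx
        exact ⟨w⟩
    have : Nonempty V := ⟨a⟩
    exact ⟨fun x y => (hreach x).trans (hreach y).symm⟩
  have hsame : ∀ x y, T'.Reachable x y → T1.dist x y ≤ T.dist x y := by
    intro x y h
    rw [← dist_sub_eq hT hle h]
    exact h.dist_anti hle1
  have hda : ∀ x, ¬ T'.Reachable b x → T1.dist x a ≤ T.dist x b := by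
    intro x hx
    obtain ⟨w, hw⟩ := hout x hx
    rw [T.dist_comm]
    exact (dist_le w).trans hw
  refine ⟨?_, fun x => ¬ T'.Reachable b x, ?_, ?_, ?_, ?_⟩
  · rw [isTree_iff_connected_and_card] at hT ⊢
    refine ⟨hconn, le_antisymm ?_ hconn.card_vert_le_card_edgeSet_add_one⟩
    rw [← hT.2]
    refine Nat.add_le_add_right ?_ 1
    change T1.edgeSet.ncard ≤ T.edgeSet.ncard
    have himg : ∀ c : V, {e | ∃ v ∈ Vb, e = s(c, v)}.ncard = Vb.ncard := by
      intro c
      have : {e | ∃ v ∈ Vb, e = s(c, v)} = Set.image (fun v => s(c, v)) Vb := by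
        ext e; simp [eq_comm]
      rw [this]
      exact Set.ncard_image_of_injective _ (fun x y h => Sym2.congr_right.1 h)
    have hsub : S ⊆ T.edgeSet := by
      rintro e ⟨v, hv, rfl⟩
      exact hVbT hv
    have h1 : T1.edgeSet ⊆ (T.edgeSet \ S) ∪ {e | ∃ v ∈ Vb, e = s(a, v)} := by
      rw [hT1, edgeSet_fromEdgeSet]
      exact Set.sdiff_subset
    have h2 := Set.ncard_le_ncard h1 (Set.toFinite _)
    have h3 := Set.ncard_union_le (T.edgeSet \ S) {e | ∃ v ∈ Vb, e = s(a, v)}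
    have h4 := Set.ncard_sdiff_add_ncard_of_subset hsub (Set.toFinite _)
    have h5 := himg a
    have h6 : S.ncard = Vb.ncard := himg b
    omega
  · obtain ⟨v, hv⟩ := hVb
    refine ⟨v, fun h => ?_⟩
    have h1 := dist_sub_eq hT hle h
    have h2 : T.dist b v = 1 := dist_eq_one_iff_adj.2 (hVbT hv)
    rw [h2, dist_eq_one_iff_adj, hT', deleteEdges_adj] at h1
    exact h1.2 ⟨v, hv, rfl⟩
  · intro x hx
    exact dist_split hT (Vb := Vb) (fun h => hx (hra.symm.trans h))
  · intro x y hx hy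
    rw [not_not] at hy
    have h1 := dist_split hT (Vb := Vb) (x := x) (y := y) (fun h => hx (hy.trans h.symm))
    have h2 := hda x hx
    have h3 := hsame a y (hra.trans hy)
    have h4 := hconn.dist_triangle (u := x) (v := a) (w := y)
    omega
  · intro x y hxy
    by_cases h : T'.Reachable x y
    · exact hsame x y h
    · have hx : ¬ T'.Reachable b x := by
        intro hx
        have hy : T'.Reachable b y := by tauto
        exact h (hx.symm.trans hy)
      have hy : ¬ T'.Reachable b y := by tauto
      have h1 := dist_split hT (Vb := Vb) (x := x) (y := y) h
      have h2 := hda x hx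
      have h3 := hda y hy
      have h4 := hconn.dist_triangle (u := x) (v := a) (w := y)
      rw [T1.dist_comm (u := y)] at h3
      rw [T.dist_comm (u := y)] at h3
      omega

open Classical in
lemma sum_bound {V : Type*} [Fintype V] (T T1 : SimpleGraph V) (B : V → Prop) (s : V → ℤ)
    (h1 : ∀ x y, B x → ¬ B y → (T1.dist x y : ℤ) ≤ T.dist x y + s y)
    (h2 : ∀ x y, (B x ↔ B y) → T1.dist x y ≤ T.dist x y) :
    ((∑ u : V, ∑ v : V, T1.dist u v : ℕ) : ℤ) ≤ (∑ u : V, ∑ v : V, T.dist u v : ℕ) +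
      2 * ((∑ x, if B x then 1 else 0) * ∑ y, if B y then 0 else s y) := by
  have hpt : ∀ x y, (T1.dist x y : ℤ) ≤ T.dist x y +
      ((if B x then 1 else 0) * (if B y then 0 else s y) +
       (if B x then 0 else s x) * (if B y then 1 else 0)) := by
    intro x y
    by_cases hx : B x <;> by_cases hy : B y
    · simpa [hx, hy] using h2 x y (by tauto)
    · simpa [hx, hy] using h1 x y hx hy
    · have := h1 y x hy hx
      rw [T1.dist_comm, T.dist_comm] at this
      simpa [hx, hy] using this
    · simpa [hx, hy] using h2 x y (by tauto)
  have := Finset.sum_le_sum (s := Finset.univ) fun x _ =>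
    Finset.sum_le_sum (s := Finset.univ) fun y _ => hpt x y
  simp only [Finset.sum_add_distrib, ← Finset.mul_sum, ← Finset.sum_mul] at this
  push_cast
  linarith

theorem stmt0 {V : Type*} [Fintype V] (G : SimpleGraph V) (hG : G.Connected)
    (a b : V) (hab : a ≠ b) (Va Vb : Set V) (hVa : Va.Nonempty) (hVb : Vb.Nonempty)
    (hN : ∀ v ∈ Va ∪ Vb, G.Adj v a ∧ G.Adj v b)
    (T : SimpleGraph V) (hT : IsSpanningTree G T)
    (hVaT : Va ⊆ T.neighborSet a) (hVbT : Vb ⊆ T.neighborSet b)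
    (hpath : ∀ p : T.Walk a b, p.IsPath → ∀ v ∈ Va ∪ Vb, v ∉ p.support)
    (T1 T2 : SimpleGraph V)
    (hT1 : T1 = SimpleGraph.fromEdgeSet
      ((T.edgeSet \ {e | ∃ v ∈ Vb, e = s(b, v)}) ∪ {e | ∃ v ∈ Vb, e = s(a, v)}))
    (hT2 : T2 = SimpleGraph.fromEdgeSet
      ((T.edgeSet \ {e | ∃ v ∈ Va, e = s(a, v)}) ∪ {e | ∃ v ∈ Va, e = s(b, v)})) :
    IsSpanningTree G T1 ∧ IsSpanningTree G T2 ∧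
      min (wiener T1) (wiener T2) < wiener T := by
  classical
  obtain ⟨hTG, hTt⟩ := hT
  have hpath' : ∀ p : T.Walk b a, p.IsPath → ∀ v ∈ Va, v ∉ p.support := by
    intro p hp v hv hvp
    exact hpath p.reverse hp.reverse v (Or.inl hv) (by simpa using hvp)
  obtain ⟨ht1, B, ⟨xb, hxb⟩, hB, hB1, hB2⟩ := key T hTt a b hab Vb hVb hVbT
    (fun p hp v hv => hpath p hp v (Or.inr hv)) T1 hT1
  obtain ⟨ht2, A, ⟨xa, hxa⟩, hA, hA1, hA2⟩ := key T hTt b a hab.symm Va hVa hVaT hpath' T2 hT2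
  refine ⟨⟨?_, ht1⟩, ⟨?_, ht2⟩, ?_⟩
  · intro x y hxy
    rw [hT1, fromEdgeSet_adj] at hxy
    obtain ⟨h | ⟨v, hv, he⟩, -⟩ := hxy
    · exact hTG h.1
    · rw [← mem_edgeSet, he]
      exact (hN v (Or.inr hv)).1.symm
  · intro x y hxy
    rw [hT2, fromEdgeSet_adj] at hxy
    obtain ⟨h | ⟨v, hv, he⟩, -⟩ := hxy
    · exact hTG h.1
    · rw [← mem_edgeSet, he]
      exact (hN v (Or.inl hv)).2.symm
  have hD : 0 < T.dist a b := hTt.connected.pos_dist_of_ne hab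
  have b1 := sum_bound T T1 B (fun y => (T.dist a y : ℤ) - T.dist b y) hB1 hB2
  have b2 := sum_bound T T2 A (fun y => (T.dist b y : ℤ) - T.dist a y) hA1 hA2
  have cB : (1 : ℤ) ≤ ∑ x, if B x then 1 else 0 := by
    have := Finset.single_le_sum (f := fun x => if B x then (1 : ℤ) else 0) (s := Finset.univ)
      (fun i _ => by split_ifs <;> simp) (Finset.mem_univ xb)
    simpa [hxb] using this
  have cA : (1 : ℤ) ≤ ∑ x, if A x then 1 else 0 := by
    have := Finset.single_le_sum (f := fun x => if A x then (1 : ℤ) else 0) (s := Finset.univ)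
      (fun i _ => by split_ifs <;> simp) (Finset.mem_univ xa)
    simpa [hxa] using this
  have hneg : (∑ y, if B y then 0 else ((T.dist a y : ℤ) - T.dist b y)) +
      (∑ y, if A y then 0 else ((T.dist b y : ℤ) - T.dist a y)) < 0 := by
    rw [← Finset.sum_add_distrib]
    rw [T.dist_comm (u := b)] at hA
    apply Finset.sum_neg'
    · intro y _
      have h1 := hA y
      have h2 := hB y
      by_cases hy : A y <;> by_cases hz : B y <;>
        simp only [hy, hz, if_true, if_false, true_implies, false_implies] at h1 h2 ⊢ <;> omega
    · refine ⟨xa, Finset.mem_univ _, ?_⟩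
      have := hA xa hxa
      have := hB xa
      have hnb : ¬ B xa := by
        intro h
        have := hB xa h
        omega
      simp only [hxa, hnb, if_true, if_false]
      omega
  unfold wiener
  rw [min_lt_iff]
  by_cases hc : (∑ y, if B y then 0 else ((T.dist a y : ℤ) - T.dist b y)) < 0
  · left
    have : (∑ x, if B x then (1 : ℤ) else 0) *
      (∑ y, if B y then 0 else ((T.dist a y : ℤ) - T.dist b y)) ≤ -1 := by nlinarith
    omega
  · right
    have : (∑ x, if A x then (1 : ℤ) else 0) *
      (∑ y, if A y then 0 else ((T.dist b y : ℤ) - T.dist a y)) ≤ -1 := by nlinarith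
    omega
end

section
/- Let G be a finite connected simple graph with a modular partition P = {M_1, …, M_k}. Let T be a MAD tree of G with a root r ∈ M_i. Then for every j ≠ i there is no edge uv ∈ E(T) with both endpoints u, v ∈ M_j. -/
open SimpleGraph

/-- `T` is a MAD tree of `G`: a spanning tree minimizing the Wiener index among
all spanning trees of `G`. -/
def IsMADTree {V : Type*} [Fintype V] (G T : SimpleGraph V) : Prop :=
  IsSpanningTree G T ∧ ∀ T' : SimpleGraph V, IsSpanningTree G T' → wiener T ≤ wiener T'

/-- A module of `G`: every vertex outside `M` is adjacent to all vertices of `M`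
or to none of them. -/
def IsModule {V : Type*} (G : SimpleGraph V) (M : Set V) : Prop :=
  ∀ x ∉ M, (∀ v ∈ M, G.Adj x v) ∨ (∀ v ∈ M, ¬ G.Adj x v)

/-- A modular partition `M_1, …, M_k` (with `k ≥ 2`) of the vertex set of `G`
into (nonempty, pairwise disjoint, covering) modules. -/
def IsModularPartition {V : Type*} (G : SimpleGraph V) {k : ℕ} (M : Fin k → Set V) : Prop :=
  2 ≤ k ∧ (∀ j, (M j).Nonempty) ∧ (∀ j, IsModule G (M j)) ∧
    (Pairwise fun j j' => Disjoint (M j) (M j')) ∧ (⋃ j, M j) = Set.univ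

/-- `r` is a root of the spanning tree `T` of `G`: every path in `T` starting at `r`
is an induced path in `G`, i.e. any two vertices of the path that are adjacent in `G`
are consecutive on the path. -/
def IsRoot {V : Type*} (G T : SimpleGraph V) (r : V) : Prop :=
  ∀ ⦃v : V⦄ (p : T.Walk r v), p.IsPath →
    ∀ x ∈ p.support, ∀ y ∈ p.support, G.Adj x y → s(x, y) ∈ p.edges

/-- `T` is a poly-star with respect to the partition `M`: every part contains at most
one vertex of degree at least 2 in `T`. -/
def IsPolyStar {V : Type*} (T : SimpleGraph V) {k : ℕ} (M : Fin k → Set V) : Prop :=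
  ∀ j : Fin k, ∀ u ∈ M j, ∀ v ∈ M j,
    2 ≤ (T.neighborSet u).ncard → 2 ≤ (T.neighborSet v).ncard → u = v

theorem no_edge_aux {V : Type*} (G T : SimpleGraph V) (hle : T ≤ G) (M : Set V)
    (hM : IsModule G M) (r : V) (hr : r ∉ M) (hroot : IsRoot G T r)
    (a b : V) (ha : a ∈ M) (hb : b ∈ M) (hab : T.Adj a b)
    (p : T.Walk r a) (hp : p.IsPath) (hbp : b ∉ p.support) : False := by
  obtain ⟨d, hd, h1, h2⟩ := p.exists_boundary_dart Mᶜ hr (by simpa using ha)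
  have h1' : d.fst ∉ M := h1
  have h2' : d.snd ∈ M := by simpa using h2
  have hadj : G.Adj d.fst b := by
    rcases hM d.fst h1' with h | h
    · exact h b hb
    · exact absurd (hle d.adj) (h _ h2')
  have hx := hroot (p.concat hab) (hp.concat hbp hab) d.fst
    (by rw [Walk.support_concat]; simp [p.dart_fst_mem_support_of_mem_darts hd]) b
    (by rw [Walk.support_concat]; simp) hadj
  rw [Walk.edges_concat] at hx
  simp only [List.concat_eq_append, List.mem_append, List.mem_singleton, Sym2.eq_iff] at hx
  rcases hx with hx | ⟨hx, -⟩ | ⟨hx, -⟩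
  · exact hbp (p.snd_mem_support_of_mem_edges hx)
  · exact h1' (hx ▸ ha)
  · exact h1' (hx ▸ hb)

theorem stmt1 {V : Type*} [Fintype V] (G : SimpleGraph V) (hG : G.Connected)
    {k : ℕ} (M : Fin k → Set V) (hM : IsModularPartition G M)
    (T : SimpleGraph V) (hT : IsMADTree G T)
    (i : Fin k) (r : V) (hr : r ∈ M i) (hroot : IsRoot G T r) :
    ∀ j : Fin k, j ≠ i → ∀ u ∈ M j, ∀ v ∈ M j, ¬ T.Adj u v := by
  classical
  intro j hj u hu v hv huv
  obtain ⟨-, -, hmod, hdis, -⟩ := hM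
  have hrj : r ∉ M j := fun h => Set.disjoint_left.mp (hdis hj) h hr
  obtain ⟨⟨hle, htree⟩, -⟩ := hT
  obtain ⟨p, hp⟩ := (htree.connected r u).exists_isPath
  by_cases hvp : v ∈ p.support
  · exact no_edge_aux G T hle (M j) (hmod j) r hrj hroot v u hv hu huv.symm
      (p.takeUntil v hvp) (hp.takeUntil hvp)
      (Walk.endpoint_notMem_support_takeUntil hp hvp huv.ne)
  · exact no_edge_aux G T hle (M j) (hmod j) r hrj hroot u v hu hv huv p hp hvp
end

section
/- Let G be a finite connected simple graph with a modular partition P = {M_1, …, M_k}. Let T be a MAD tree of G with a root r ∈ M_i. Then for every module M_j ∈ P with j ≠ i there is at most one vertex d ∈ M_j with degree at least 2 in T. -/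
open SimpleGraph

/-- A map that contracts or preserves edges does not increase distances. -/
lemma aux_map {V : Type*} {T T' : SimpleGraph V} (f : V → V)
    (hf : ∀ u v, T.Adj u v → f u = f v ∨ T'.Adj (f u) (f v)) {u v : V} (p : T.Walk u v) :
    ∃ q : T'.Walk (f u) (f v), q.length ≤ p.length := by
  induction p with
  | nil => exact ⟨Walk.nil, le_rfl⟩
  | cons h p ih =>
    obtain ⟨q, hq⟩ := ih
    rcases hf _ _ h with e | e
    · refine ⟨q.copy e.symm rfl, ?_⟩
      simp; omega
    · refine ⟨Walk.cons e q, ?_⟩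
      simp; omega

lemma aux_dist {V : Type*} {T T' : SimpleGraph V} (hT : T.Connected) (f : V → V)
    (hf : ∀ u v, T.Adj u v → f u = f v ∨ T'.Adj (f u) (f v)) (u v : V) :
    T'.dist (f u) (f v) ≤ T.dist u v ∧ T'.Reachable (f u) (f v) := by
  obtain ⟨p, hp⟩ := hT.exists_walk_length_eq_dist u v
  obtain ⟨q, hq⟩ := aux_map f hf p
  exact ⟨(dist_le q).trans (hq.trans hp.le), ⟨q⟩⟩

/-- The vertices separated from `d'` by `d`. -/
def sepSet {V : Type*} (T : SimpleGraph V) (d d' : V) : Set V :=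
  {v | v ≠ d ∧ ∀ p : T.Walk d' v, d ∈ p.support}

lemma sep_cut {V : Type*} {T : SimpleGraph V} {d d' u v : V} (hu : u ∈ sepSet T d d')
    (hv : v ∉ sepSet T d d') (h : T.Adj u v) : v = d := by
  by_contra hne
  simp only [sepSet, Set.mem_ofPred_eq, not_and, not_forall] at hv
  obtain ⟨p, hp⟩ := hv hne
  have := hu.2 (p.concat h.symm)
  rw [Walk.support_concat] at this
  simp at this
  rcases this with h1 | h1
  · exact hp h1
  · exact hu.1 h1.symm

lemma sep_walk {V : Type*} {T : SimpleGraph V} {d d' u v : V} (p : T.Walk u v)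
    (hu : u ∈ sepSet T d d') (hv : v ∉ sepSet T d d') : d ∈ p.support := by
  induction p with
  | nil => exact absurd hu hv
  | @cons a b c h p ih =>
    by_cases hb : b ∈ sepSet T d d'
    · simp [ih hb hv]
    · have := sep_cut hu hb h
      subst this
      simp

lemma sep_dist {V : Type*} {T : SimpleGraph V} (hT : T.Connected) {d d' u v : V}
    (hu : u ∈ sepSet T d d') (hv : v ∉ sepSet T d d') :
    T.dist u v = T.dist u d + T.dist d v := by
  classical
  apply le_antisymm hT.dist_triangle
  obtain ⟨p, hp⟩ := hT.exists_walk_length_eq_dist u v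
  have hd := sep_walk p hu hv
  have h1 := congrArg Walk.length (p.take_spec hd)
  rw [Walk.length_append] at h1
  have h2 := dist_le (p.takeUntil d hd)
  have h3 := dist_le (p.dropUntil d hd)
  omega

/-- The tree obtained by re-attaching the separated part to `d'`. -/
def moveTree {V : Type*} (T : SimpleGraph V) (d d' : V) (A : Set V) (hA : d' ∉ A) :
    SimpleGraph V where
  Adj u v := (u ∈ A ∧ v ∈ A ∧ T.Adj u v) ∨ (u ∉ A ∧ v ∉ A ∧ T.Adj u v) ∨
    (u ∈ A ∧ v = d' ∧ T.Adj u d) ∨ (v ∈ A ∧ u = d' ∧ T.Adj v d)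
  symm := ⟨by
    intro u v h
    rcases h with h | h | h | h
    · exact Or.inl ⟨h.2.1, h.1, h.2.2.symm⟩
    · exact Or.inr (Or.inl ⟨h.2.1, h.1, h.2.2.symm⟩)
    · exact Or.inr (Or.inr (Or.inr h))
    · exact Or.inr (Or.inr (Or.inl h))⟩
  loopless := ⟨by
    intro u h
    rcases h with h | h | h | h
    · exact h.2.2.ne rfl
    · exact h.2.2.ne rfl
    · exact hA (h.2.1 ▸ h.1)
    · exact hA (h.2.1 ▸ h.1)⟩

lemma move_edges {V : Type*} [Fintype V] (T : SimpleGraph V) (d d' : V) (A : Set V)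
    (hA : d' ∉ A) (hd : d ∉ A) :
    Nat.card (moveTree T d d' A hA).edgeSet ≤ Nat.card T.edgeSet := by
  classical
  let F : Sym2 V → Sym2 V := fun e =>
    if ∃ a ∈ A, e = s(a, d) then Sym2.map (fun x => if x = d then d' else x) e else e
  have key : (moveTree T d d' A hA).edgeSet ⊆ F '' T.edgeSet := by
    have hFa : ∀ a ∈ A, F s(a, d) = s(a, d') := by
      intro a ha
      have hne : a ≠ d := fun h => hd (h ▸ ha)
      have : ∃ a' ∈ A, s(a, d) = s(a', d) := ⟨a, ha, rfl⟩
      simp only [F, if_pos this, Sym2.map_mk]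
      simp [hne]
    intro e he
    induction e with
    | _ u v =>
    rw [mem_edgeSet] at he
    rcases he with h | h | h | h
    · refine ⟨s(u, v), h.2.2, ?_⟩
      have : ¬ ∃ a ∈ A, s(u, v) = s(a, d) := by
        rintro ⟨a, ha, h'⟩
        have : d ∈ s(u, v) := by rw [h']; simp
        rcases Sym2.mem_iff.1 this with e | e
        · exact hd (e ▸ h.1)
        · exact hd (e ▸ h.2.1)
      simp only [F, if_neg this]
    · refine ⟨s(u, v), h.2.2, ?_⟩
      have : ¬ ∃ a ∈ A, s(u, v) = s(a, d) := by
        rintro ⟨a, ha, h'⟩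
        have : a ∈ s(u, v) := by rw [h']; simp
        rcases Sym2.mem_iff.1 this with e | e
        · exact h.1 (e ▸ ha)
        · exact h.2.1 (e ▸ ha)
      simp only [F, if_neg this]
    · refine ⟨s(u, d), h.2.2, ?_⟩
      rw [hFa u h.1, h.2.1]
    · refine ⟨s(v, d), h.2.2, ?_⟩
      rw [hFa v h.1, h.2.1, Sym2.eq_swap]
  rw [Nat.card_coe_set_eq, Nat.card_coe_set_eq]
  exact (Set.ncard_le_ncard key (Set.toFinite _)).trans (Set.ncard_image_le (Set.toFinite _))

/-- Re-attaching: the new graph is a tree and has controlled distances. -/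
lemma move_main {V : Type*} [Fintype V] {T : SimpleGraph V} (hT : T.IsTree) {d d' : V}
    (hA : d' ∉ sepSet T d d') :
    (moveTree T d d' (sepSet T d d') hA).IsTree ∧
    (∀ x ∉ sepSet T d d', ∀ y ∉ sepSet T d d',
      (moveTree T d d' (sepSet T d d') hA).dist x y ≤ T.dist x y) ∧
    (∀ x ∈ sepSet T d d', ∀ y ∈ sepSet T d d',
      (moveTree T d d' (sepSet T d d') hA).dist x y ≤ T.dist x y) ∧
    (∀ x ∈ sepSet T d d', ∀ y ∉ sepSet T d d',
      (moveTree T d d' (sepSet T d d') hA).dist x y + T.dist d y ≤ T.dist x y + T.dist d' y) := by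
  classical
  have hd : d ∉ sepSet T d d' := fun h => h.1 rfl
  have hTc : T.Connected := hT.connected
  have hcut := fun u v => @sep_cut V T d d' u v
  have hsd := fun u v => @sep_dist V T hTc d d' u v
  have hedges := move_edges T d d' (sepSet T d d') hA hd
  generalize sepSet T d d' = A at *
  set T' := moveTree T d d' A hA with hT'
  have h1 := aux_dist (T' := T') hTc (fun x => if x ∈ A then d else x) (by
    intro u v h
    by_cases hu : u ∈ A <;> by_cases hv : v ∈ A
    · simp [hu, hv]
    · left; simp [hu, hv, hcut u v hu hv h]
    · left; simp [hu, hv, hcut v u hv hu h.symm]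
    · right; simp only [hu, hv, if_false]; exact Or.inr (Or.inl ⟨hu, hv, h⟩))
  have h2 := aux_dist (T' := T') hTc (fun x => if x ∈ A then x else d') (by
    intro u v h
    by_cases hu : u ∈ A <;> by_cases hv : v ∈ A
    · right; simp only [hu, hv, if_true]; exact Or.inl ⟨hu, hv, h⟩
    · right; simp only [hu, hv, if_true, if_false]
      have := hcut u v hu hv h
      subst this
      exact Or.inr (Or.inr (Or.inl ⟨hu, rfl, h⟩))
    · right; simp only [hu, hv, if_true, if_false]
      have := hcut v u hv hu h.symm
      subst this
      exact Or.inr (Or.inr (Or.inr ⟨hv, rfl, h.symm⟩))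
    · left; simp [hu, hv])
  have hreach : ∀ x, T'.Reachable x d' := by
    intro x
    by_cases hx : x ∈ A
    · have := (h2 x d).2
      simpa [hx, hd] using this
    · have := (h1 x d').2
      simpa [hx, hA] using this
  have hc : T'.Connected := by
    haveI : Nonempty V := ⟨d⟩
    exact ⟨fun x y => (hreach x).trans (hreach y).symm⟩
  refine ⟨?_, ?_, ?_, ?_⟩
  · rw [isTree_iff_connected_and_card]
    refine ⟨hc, ?_⟩
    have := (isTree_iff_connected_and_card.1 hT).2
    have := hc.card_vert_le_card_edgeSet_add_one
    omega
  · intro x hx y hy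
    simpa [hx, hy] using (h1 x y).1
  · intro x hx y hy
    simpa [hx, hy] using (h2 x y).1
  · intro x hx y hy
    have e1 := hsd x y hx hy
    have e2 : T'.dist x d' ≤ T.dist x d := by simpa [hx, hd] using (h2 x d).1
    have e3 : T'.dist d' y ≤ T.dist d' y := by simpa [hA, hy] using (h1 d' y).1
    have e4 : T'.dist x y ≤ T'.dist x d' + T'.dist d' y := hc.dist_triangle
    omega

/-- The summation argument. -/
lemma sum_main {V : Type*} [Fintype V] (A : Set V) (f f' : V → V → ℕ) (d d' : V)
    (hA : A.Nonempty) (hpos : 0 < f d' d)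
    (hs : ∀ x y, f x y = f y x) (hs' : ∀ x y, f' x y = f' y x)
    (h0 : ∀ x ∈ A, f d' x = f d' d + f d x)
    (h1 : ∀ x ∉ A, ∀ y ∉ A, f' x y ≤ f x y)
    (h2 : ∀ x ∈ A, ∀ y ∈ A, f' x y ≤ f x y)
    (h3 : ∀ x ∈ A, ∀ y ∉ A, f' x y + f d y ≤ f x y + f d' y)
    (hle : ∑ y, f d' y ≤ ∑ y, f d y) :
    ∑ x, ∑ y, f' x y + 2 ≤ ∑ x, ∑ y, f x y := by
  classical
  let ι : V → ℤ := fun x => if x ∈ A then 1 else 0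
  let g : V → ℤ := fun y => if y ∈ A then 0 else (f d' y : ℤ) - f d y
  have hpt : ∀ x y, (f' x y : ℤ) ≤ f x y + (ι x * g y + ι y * g x) := by
    intro x y
    by_cases hx : x ∈ A <;> by_cases hy : y ∈ A
    · have := h2 x hx y hy
      simp [ι, g, hx, hy, this]
    · have := h3 x hx y hy
      simp [ι, g, hx, hy]; omega
    · have := h3 y hy x hx
      rw [hs y x, hs' y x] at this
      simp [ι, g, hx, hy]; omega
    · have := h1 x hx y hy
      simp [ι, g, hx, hy, this]
  have hsum : (∑ x, ∑ y, (f' x y : ℤ)) ≤ ∑ x, ∑ y, ((f x y : ℤ) + (ι x * g y + ι y * g x)) :=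
    Finset.sum_le_sum fun x _ => Finset.sum_le_sum fun y _ => hpt x y
  have e : ∑ x, ∑ y, ((f x y : ℤ) + (ι x * g y + ι y * g x)) =
      ∑ x, ∑ y, (f x y : ℤ) + 2 * ((∑ x, ι x) * ∑ y, g y) := by
    simp only [Finset.sum_add_distrib]
    have a1 : ∑ x, ∑ y, ι x * g y = (∑ x, ι x) * ∑ y, g y := by
      rw [Finset.sum_mul_sum]
    have a2 : ∑ x, ∑ y, ι y * g x = (∑ x, ι x) * ∑ y, g y := by
      rw [Finset.sum_comm, Finset.sum_mul_sum]
    rw [a1, a2]; ring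
  have hι : 1 ≤ ∑ x, ι x := by
    obtain ⟨a, ha⟩ := hA
    have : ι a ≤ ∑ x, ι x := Finset.single_le_sum (f := ι)
      (fun x _ => by by_cases hx : x ∈ A <;> simp [ι, hx]) (Finset.mem_univ a)
    simpa [ι, ha] using this
  have hg : ∑ y, g y = ∑ y, (f d' y : ℤ) - ∑ y, (f d y : ℤ) - (∑ y, ι y) * f d' d := by
    rw [Finset.sum_mul, ← Finset.sum_sub_distrib, ← Finset.sum_sub_distrib]
    refine Finset.sum_congr rfl fun y _ => ?_
    by_cases hy : y ∈ A
    · have := h0 y hy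
      simp [g, ι, hy]; omega
    · simp [g, ι, hy]
  have hle' : ∑ y, (f d' y : ℤ) ≤ ∑ y, (f d y : ℤ) := by exact_mod_cast hle
  have hgneg : ∑ y, g y ≤ -1 := by
    have : (1 : ℤ) ≤ f d' d := by exact_mod_cast hpos
    nlinarith
  have : (∑ x, ι x) * ∑ y, g y ≤ -1 := by nlinarith
  have fin : (∑ x, ∑ y, (f' x y : ℤ)) + 2 ≤ ∑ x, ∑ y, (f x y : ℤ) := by linarith
  exact_mod_cast fin

/-- A path starting at a root outside a module meets the module at most once. -/
lemma root_once {V : Type*} {G T : SimpleGraph V} (hTG : T ≤ G) {r : V}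
    (hroot : IsRoot G T r) {M : Set V} (hM : IsModule G M) (hr : r ∉ M) {w : V}
    (p : T.Walk r w) (hp : p.IsPath) {x y : V} (hx : x ∈ p.support) (hy : y ∈ p.support)
    (hxM : x ∈ M) (hyM : y ∈ M) : x = y := by
  classical
  have hex : ∃ n, n ≤ p.length ∧ p.getVert n ∈ M := by
    obtain ⟨n, hn, hn'⟩ := Walk.mem_support_iff_exists_getVert.1 hx
    exact ⟨n, hn', hn ▸ hxM⟩
  obtain ⟨hnl, hnM⟩ := Nat.find_spec hex
  have hmin := fun m => @Nat.find_min _ _ hex m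
  generalize Nat.find hex = n at *
  have hn0 : n ≠ 0 := by
    rintro rfl
    simp at hnM
    exact hr hnM
  obtain ⟨m, rfl⟩ := Nat.exists_eq_succ_of_ne_zero hn0
  have hzM : p.getVert m ∉ M := fun h => hmin m (by omega) ⟨by omega, h⟩
  have hadj : T.Adj (p.getVert m) (p.getVert (m + 1)) := p.adj_getVert_succ (by omega)
  have hall : ∀ v ∈ M, G.Adj (p.getVert m) v := by
    rcases hM _ hzM with h | h
    · exact h
    · exact absurd (hTG hadj) (h _ hnM)
  have hinj := hp.getVert_injOn
  have huniq : ∀ v ∈ p.support, v ∈ M → v = p.getVert (m + 1) := by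
    intro v hv hvM
    have he := hroot p hp _ (p.getVert_mem_support m) v hv (hall v hvM)
    rw [← Walk.mem_edges_toSubgraph, Subgraph.mem_edgeSet, Walk.toSubgraph_adj_iff] at he
    obtain ⟨i, hi, hil⟩ := he
    rw [Sym2.eq_iff] at hi
    rcases hi with ⟨a, b⟩ | ⟨a, b⟩
    · have : i = m := hinj (by simp; omega) (by simp; omega) a
      rw [← b, this]
    · have : i + 1 = m := hinj (by simp; omega) (by simp; omega) b
      exact absurd ⟨by omega, a ▸ hvM⟩ (hmin i (by omega))
  rw [huniq x hx hxM, huniq y hy hyM]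

lemma sep_nonempty {V : Type*} [Fintype V] {T : SimpleGraph V} (hT : T.IsTree) {d d' : V}
    (hdeg : 2 ≤ (T.neighborSet d).ncard) : (sepSet T d d').Nonempty := by
  classical
  obtain ⟨u, hu, v, hv, huv⟩ := (Set.one_lt_ncard (Set.toFinite _)).1 hdeg
  rw [mem_neighborSet] at hu hv
  by_contra hemp
  rw [Set.not_nonempty_iff_eq_empty] at hemp
  have key : ∀ w, T.Adj d w → ∃ q : T.Walk w d', (q.IsPath ∧ d ∉ q.support) := by
    intro w hw
    have hw' : w ∉ sepSet T d d' := by rw [hemp]; simp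
    simp only [sepSet, Set.mem_ofPred_eq, not_and, not_forall] at hw'
    obtain ⟨p, hp⟩ := hw' hw.ne'
    refine ⟨p.reverse.bypass, p.reverse.bypass_isPath, fun h => hp ?_⟩
    have := p.reverse.support_bypass_subset_support h
    simpa using this
  obtain ⟨q1, hq1, hq1'⟩ := key u hu
  obtain ⟨q2, hq2, hq2'⟩ := key v hv
  have e := (hT.existsUnique_path d d').unique
    (y₁ := Walk.cons hu q1) (y₂ := Walk.cons hv q2)
    (by simp [hq1, hq1']) (by simp [hq2, hq2'])
  have e1 := congrArg (fun w => w.getVert 1) e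
  simp at e1
  exact huv e1

lemma core {V : Type*} [Fintype V] {G T : SimpleGraph V} (hT : IsMADTree G T) {r : V}
    (hroot : IsRoot G T r) {M : Set V} (hM : IsModule G M) (hr : r ∉ M) {d d' : V}
    (hd : d ∈ M) (hd' : d' ∈ M) (hdeg : 2 ≤ (T.neighborSet d).ncard) (hne : d ≠ d')
    (hle : ∑ y, T.dist d' y ≤ ∑ y, T.dist d y) : False := by
  classical
  obtain ⟨⟨hTG, htree⟩, hmin⟩ := hT
  have hA : d' ∉ sepSet T d d' := by
    intro h
    have := h.2 Walk.nil
    simp at this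
    exact hne this
  have hdA : d ∉ sepSet T d d' := fun h => h.1 rfl
  obtain ⟨t1, t2, t3, t4⟩ := move_main htree hA
  have hrA : r ∉ sepSet T d d' := by
    intro h
    obtain ⟨p, hp, -⟩ := htree.existsUnique_path r d'
    have h1 := h.2 p.reverse
    rw [Walk.support_reverse, List.mem_reverse] at h1
    exact hne (root_once hTG hroot hM hr p hp h1 p.end_mem_support hd hd')
  have hGadj : ∀ a ∈ sepSet T d d', T.Adj a d → G.Adj a d' := by
    intro a ha had
    have haM : a ∉ M := by
      intro haM
      obtain ⟨p, hp, -⟩ := htree.existsUnique_path r a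
      have h1 := sep_walk p.reverse ha hrA
      rw [Walk.support_reverse, List.mem_reverse] at h1
      exact ha.1 (root_once hTG hroot hM hr p hp h1 p.end_mem_support hd haM).symm
    rcases hM a haM with h | h
    · exact h d' hd'
    · exact absurd (hTG had) (h d hd)
  have hle' : moveTree T d d' (sepSet T d d') hA ≤ G := by
    intro u v h
    rcases h with h | h | h | h
    · exact hTG h.2.2
    · exact hTG h.2.2
    · rw [h.2.1]; exact hGadj u h.1 h.2.2
    · rw [h.2.1]; exact (hGadj v h.1 h.2.2).symm
  have hw := hmin _ ⟨hle', t1⟩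
  have hs := sum_main (sepSet T d d') T.dist (moveTree T d d' (sepSet T d d') hA).dist d d'
    (sep_nonempty htree hdeg) (htree.connected.pos_dist_of_ne hne.symm)
    (fun x y => dist_comm) (fun x y => dist_comm)
    (fun x hx => by
      have := sep_dist htree.connected hx hA
      rw [T.dist_comm (u := d') (v := x), this, T.dist_comm (u := d) (v := x),
        T.dist_comm (u := d) (v := d')]
      omega)
    t2 t3 t4 hle
  unfold wiener at hw
  omega

theorem stmt2 {V : Type*} [Fintype V] (G : SimpleGraph V) (hG : G.Connected)
    {k : ℕ} (M : Fin k → Set V) (hM : IsModularPartition G M)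
    (T : SimpleGraph V) (hT : IsMADTree G T)
    (i : Fin k) (r : V) (hr : r ∈ M i) (hroot : IsRoot G T r) :
    ∀ j : Fin k, j ≠ i → ∀ d ∈ M j, ∀ d' ∈ M j,
      2 ≤ (T.neighborSet d).ncard → 2 ≤ (T.neighborSet d').ncard → d = d' := by
  intro j hj d hd d' hd' h1 h2
  obtain ⟨-, -, hmod, hdisj, -⟩ := hM
  have hrj : r ∉ M j := fun h => Set.disjoint_left.1 (hdisj hj) h hr
  by_contra hne
  rcases le_total (∑ y, T.dist d' y) (∑ y, T.dist d y) with h | h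
  · exact core hT hroot (hmod j) hrj hd hd' h1 hne h
  · exact core hT hroot (hmod j) hrj hd' hd h2 (Ne.symm hne) h
end

section
/- Let G be a finite connected simple graph with a modular partition P = {M_1, …, M_k} into k ≥ 2 modules. Then there exists a MAD tree T* of G that is a poly-star, i.e., every module M_j ∈ P contains at most one vertex whose degree in T* is at least 2. -/
open SimpleGraph

namespace MadAux

variable {V : Type*}

/-- distance comparison across an edge -/
lemma adj_cases {T : SimpleGraph V} (hT : T.IsTree) {x y : V} (h : T.Adj x y) (v : V) :
    T.dist x v = T.dist y v + 1 ∨ T.dist y v = T.dist x v + 1 := by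
  have := hT.dist_eq_dist_add_one_of_adj v h
  rw [T.dist_comm (u := x), T.dist_comm (u := y)]
  exact this

lemma exists_toward {T : SimpleGraph V} (hT : T.IsTree) {x v : V} (h : x ≠ v) :
    ∃ p, T.Adj x p ∧ T.dist p v < T.dist x v := by
  obtain ⟨p, hp⟩ := hT.connected.exists_walk_length_eq_dist x v
  cases p with
  | nil => exact absurd rfl h
  | cons hadj q =>
    refine ⟨_, hadj, ?_⟩
    have := T.dist_le q
    simp at hp
    omega

lemma toward_unique {T : SimpleGraph V} (hT : T.IsTree) {x v p q : V} (hp : T.Adj x p)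
    (hq : T.Adj x q) (hpd : T.dist p v < T.dist x v) (hqd : T.dist q v < T.dist x v) : p = q := by
  obtain ⟨P, hP⟩ := hT.connected.exists_walk_length_eq_dist p v
  obtain ⟨Q, hQ⟩ := hT.connected.exists_walk_length_eq_dist q v
  have h1 := adj_cases hT hp v
  have h2 := adj_cases hT hq v
  have hP' : (Walk.cons hp P).IsPath := by
    apply Walk.isPath_of_length_eq_dist
    simp; omega
  have hQ' : (Walk.cons hq Q).IsPath := by
    apply Walk.isPath_of_length_eq_dist
    simp; omega
  have := congrArg (fun R => R.1.snd) ((hT.isAcyclic.subsingleton_path x v).elim ⟨_, hP'⟩ ⟨_, hQ'⟩)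
  simpa using this

lemma dist_adj {T : SimpleGraph V} {x y : V} (h : T.Adj x y) : T.dist x y = 1 :=
  dist_eq_one_iff_adj.2 h

/-- two distinct neighbours are at distance two -/
lemma dist_two {T : SimpleGraph V} (hT : T.IsTree) {a b c : V} (h : T.Adj b a) (h' : T.Adj b c)
    (hne : a ≠ c) : T.dist a c = 2 := by
  have h1 := adj_cases hT h c
  have h2 := dist_adj h'
  have h3 := hT.connected.pos_dist_of_ne hne
  omega

lemma cut_edge {T : SimpleGraph V} (hT : T.IsTree) {a b x y : V} (hab : T.Adj a b)
    (hxy : T.Adj x y) (hx : T.dist x a < T.dist x b) (hy : T.dist y b < T.dist y a) :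
    x = a ∧ y = b := by
  have key : x = a := by
    by_contra hne
    obtain ⟨p, hp, hpa⟩ := exists_toward hT hne
    have h1 := adj_cases hT hab x
    have h2 := adj_cases hT hab y
    have h3 := adj_cases hT hxy a
    have h4 := adj_cases hT hxy b
    have h5 := adj_cases hT hab p
    have h6 := adj_cases hT hp a
    have h7 := adj_cases hT hp b
    simp only [T.dist_comm (u := a), T.dist_comm (u := b)] at *
    have := toward_unique hT (v := b) hp hxy (by omega) (by omega)
    subst this
    omega
  refine ⟨key, ?_⟩
  subst key
  have h1 := dist_adj hab
  have h2 := dist_adj hxy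
  rw [T.dist_comm] at h2
  exact hT.connected.dist_eq_zero_iff.1 (by omega)

variable [Fintype V]

/-- total distance of a vertex -/
noncomputable def D (T : SimpleGraph V) (v : V) : ℤ := ∑ y, (T.dist v y : ℤ)

/-- twice the Wiener index -/
noncomputable def tot (T : SimpleGraph V) : ℤ := ∑ x, D T x

lemma wiener_eq (T : SimpleGraph V) : (wiener T : ℤ) = tot T / 2 := by
  unfold wiener tot D
  push_cast
  rfl

lemma D_convex {T : SimpleGraph V} (hT : T.IsTree) {a b c : V} (h : T.Adj b a) (h' : T.Adj b c)
    (hne : a ≠ c) : 2 * D T b + 2 ≤ D T a + D T c := by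
  classical
  have : ∑ y, (2 * (T.dist b y : ℤ) + if y = b then 2 else 0)
      ≤ ∑ y, ((T.dist a y : ℤ) + T.dist c y) := by
    apply Finset.sum_le_sum
    intro y _
    by_cases hy : y = b
    · subst hy
      have h1 := dist_adj h
      have h2 := dist_adj h'
      rw [T.dist_comm] at h1 h2
      simp [h1, h2]
    · have h1 := adj_cases hT h y
      have h2 := adj_cases hT h' y
      have h3 : ¬ (T.dist a y < T.dist b y ∧ T.dist c y < T.dist b y) :=
        fun hh => hne (toward_unique hT h h' hh.1 hh.2)
      simp only [hy, if_false]
      omega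
  rw [Finset.sum_add_distrib, Finset.sum_add_distrib, ← Finset.mul_sum] at this
  simpa [D] using this

lemma D_mono {T : SimpleGraph V} (hT : T.IsTree) (v : V) : ∀ (n : ℕ) (a b : V), T.dist b v = n →
    T.Adj a b → T.dist b v < T.dist a v → D T a ≤ D T b → v ≠ b → D T b < D T v := by
  intro n
  induction n with
  | zero =>
    intro a b h _ _ _ hne
    exact absurd (hT.connected.dist_eq_zero_iff.1 h).symm hne
  | succ n ih =>
    intro a b h hab hlt hD hne
    obtain ⟨c, hc, hcv⟩ := exists_toward hT hne.symm
    have hac : a ≠ c := by rintro rfl; omega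
    have h1 := D_convex hT hab.symm hc hac
    by_cases hvc : v = c
    · subst hvc; omega
    · have h2 := adj_cases hT hc v
      have := ih b c (by omega) hc hcv (by omega) hvc
      omega

end MadAux

namespace MadAux

variable {V : Type*}

/-- Move the bundle `S`, attached to the rest of `T` only at `w`, to `v`. -/
def mv (T : SimpleGraph V) (S : Set V) (w v : V) (hv : v ∉ S) : SimpleGraph V where
  Adj x y := ((x ∈ S ↔ y ∈ S) ∧ T.Adj x y) ∨ (x ∈ S ∧ y = v ∧ T.Adj x w) ∨
    (y ∈ S ∧ x = v ∧ T.Adj y w)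
  symm := ⟨by
    intro x y h
    rcases h with ⟨h1, h2⟩ | h | h
    · exact Or.inl ⟨h1.symm, h2.symm⟩
    · exact Or.inr (Or.inr h)
    · exact Or.inr (Or.inl h)⟩
  loopless := ⟨by
    intro x h
    rcases h with ⟨_, h2⟩ | ⟨h1, h2, _⟩ | ⟨h1, h2, _⟩
    · exact T.loopless.irrefl _ h2
    · exact hv (h2 ▸ h1)
    · exact hv (h2 ▸ h1)⟩

lemma fold_walk {T T' : SimpleGraph V} (f : V → V)
    (hf : ∀ x y, T.Adj x y → f x = f y ∨ T'.Adj (f x) (f y)) {x y : V} (p : T.Walk x y) :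
    ∃ q : T'.Walk (f x) (f y), q.length ≤ p.length := by
  induction p with
  | nil => exact ⟨Walk.nil, by simp⟩
  | cons h p ih =>
    obtain ⟨q, hq⟩ := ih
    rcases hf _ _ h with h' | h'
    · exact ⟨q.copy h'.symm rfl, by simp; omega⟩
    · exact ⟨Walk.cons h' q, by simp; omega⟩

lemma fold_dist {T T' : SimpleGraph V} (hT : T.Connected) (f : V → V)
    (hf : ∀ x y, T.Adj x y → f x = f y ∨ T'.Adj (f x) (f y)) (x y : V) :
    T'.Reachable (f x) (f y) ∧ T'.dist (f x) (f y) ≤ T.dist x y := by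
  obtain ⟨p, hp⟩ := hT.exists_walk_length_eq_dist x y
  obtain ⟨q, hq⟩ := fold_walk f hf p
  exact ⟨⟨q⟩, (T'.dist_le q).trans (hq.trans hp.le)⟩

lemma mv_out {T : SimpleGraph V} (hT : T.Connected) {S : Set V} {w v : V} (hw : w ∉ S)
    (hv : v ∉ S) (hS : ∀ x ∈ S, ∀ y ∉ S, T.Adj x y → y = w) {x y : V} (hx : x ∉ S) (hy : y ∉ S) : (mv T S w v hv).Reachable x y ∧
    (mv T S w v hv).dist x y ≤ T.dist x y := by
  classical
  have := fold_dist (T' := mv T S w v hv) hT (fun x => if x ∈ S then w else x) (by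
    intro x y h
    by_cases h1 : x ∈ S <;> by_cases h2 : y ∈ S <;> simp only [h1, h2, if_true, if_false]
    · simp
    · left; exact (hS x h1 y h2 h).symm
    · left; exact hS y h2 x h1 h.symm
    · right; left; exact ⟨by simp [h1, h2], h⟩) x y
  simpa [hx, hy] using this

open Classical in
lemma mv_fold_in {T : SimpleGraph V} (hT : T.Connected) {S : Set V} {w v : V} (hw : w ∉ S)
    (hv : v ∉ S) (hS : ∀ x ∈ S, ∀ y ∉ S, T.Adj x y → y = w) (x y : V) :
    (mv T S w v hv).Reachable (if x ∈ S then x else v) (if y ∈ S then y else v) ∧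
    (mv T S w v hv).dist (if x ∈ S then x else v) (if y ∈ S then y else v) ≤ T.dist x y := by
  have := fold_dist (T' := mv T S w v hv) hT (fun x => if x ∈ S then x else v) (by
    intro x y h
    by_cases h1 : x ∈ S <;> by_cases h2 : y ∈ S <;> simp only [h1, h2, if_true, if_false]
    · right; left; exact ⟨by simp [h1, h2], h⟩
    · right; right; left
      have := hS x h1 y h2 h
      subst this
      exact ⟨h1, rfl, h⟩
    · right; right; right
      have := hS y h2 x h1 h.symm
      subst this
      exact ⟨h2, rfl, h.symm⟩
    · simp) x y
  exact this

lemma mv_in {T : SimpleGraph V} (hT : T.Connected) {S : Set V} {w v : V} (hw : w ∉ S)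
    (hv : v ∉ S) (hS : ∀ x ∈ S, ∀ y ∉ S, T.Adj x y → y = w) {x y : V} (hx : x ∈ S) (hy : y ∈ S) :
    (mv T S w v hv).dist x y ≤ T.dist x y := by
  have := (mv_fold_in hT hw hv hS x y).2
  simpa [hx, hy] using this

lemma mv_in_v {T : SimpleGraph V} (hT : T.Connected) {S : Set V} {w v : V} (hw : w ∉ S)
    (hv : v ∉ S) (hS : ∀ x ∈ S, ∀ y ∉ S, T.Adj x y → y = w) {x : V} (hx : x ∈ S) : (mv T S w v hv).Reachable x v ∧
    (mv T S w v hv).dist x v ≤ T.dist x w := by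
  have := (mv_fold_in hT hw hv hS x w)
  simpa [hx, hw] using this

lemma mv_connected {T : SimpleGraph V} (hT : T.Connected) {S : Set V} {w v : V} (hw : w ∉ S)
    (hv : v ∉ S) (hS : ∀ x ∈ S, ∀ y ∉ S, T.Adj x y → y = w) : (mv T S w v hv).Connected := by
  have : Nonempty V := ⟨v⟩
  have key : ∀ x, (mv T S w v hv).Reachable x v := by
    intro x
    by_cases hx : x ∈ S
    · exact (mv_in_v hT hw hv hS hx).1
    · exact (mv_out hT hw hv hS hx hv).1
  exact ⟨fun x y => (key x).trans (key y).symm⟩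

lemma mv_cross {T : SimpleGraph V} (hT : T.Connected) {S : Set V} {w v : V} (hw : w ∉ S)
    (hv : v ∉ S) (hS : ∀ x ∈ S, ∀ y ∉ S, T.Adj x y → y = w) {x y : V} (hx : x ∈ S) (hy : y ∉ S) :
    (mv T S w v hv).dist x y ≤ T.dist x w + T.dist v y := by
  have h1 := (mv_connected hT hw hv hS).dist_triangle (u := x) (v := v) (w := y)
  have h2 := (mv_in_v hT hw hv hS hx).2
  have h3 := (mv_out hT hw hv hS hv hy).2
  omega

lemma dist_cross {T : SimpleGraph V} (hT : T.Connected) {S : Set V} {w : V}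
    (hS : ∀ x ∈ S, ∀ y ∉ S, T.Adj x y → y = w) {x y : V} (hx : x ∈ S) (hy : y ∉ S) :
    T.dist x y = T.dist x w + T.dist w y := by
  classical
  apply le_antisymm hT.dist_triangle
  obtain ⟨p, hp⟩ := hT.exists_walk_length_eq_dist x y
  obtain ⟨d, hd, h1, h2⟩ := p.exists_boundary_dart S hx hy
  have h3 := hS _ h1 _ h2 d.adj
  have hmem : w ∈ p.support := h3 ▸ p.dart_snd_mem_support_of_mem_darts hd
  have h4 := congrArg Walk.length (p.take_spec hmem)
  rw [Walk.length_append] at h4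
  have h5 := T.dist_le (p.takeUntil w hmem)
  have h6 := T.dist_le (p.dropUntil w hmem)
  omega

lemma mv_isTree [Fintype V] {T : SimpleGraph V} (hT : T.IsTree) {S : Set V} {w v : V}
    (hw : w ∉ S) (hv : v ∉ S) (hS : ∀ x ∈ S, ∀ y ∉ S, T.Adj x y → y = w) :
    (mv T S w v hv).IsTree := by
  have hc := mv_connected hT.connected hw hv hS
  rw [isTree_iff_connected_and_card]
  refine ⟨hc, ?_⟩
  apply le_antisymm _ hc.card_vert_le_card_edgeSet_add_one
  rw [← (isTree_iff_connected_and_card.1 hT).2]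
  simp only [Nat.card_coe_set_eq]
  set X : Set V := {x | x ∈ S ∧ T.Adj x w} with hX
  set N : Set (Sym2 V) := {e | e ∈ T.edgeSet ∧ ∃ x y, e = s(x, y) ∧ (x ∈ S ↔ y ∈ S)} with hN
  have h1 : (mv T S w v hv).edgeSet ⊆ N ∪ (fun x => s(x, v)) '' X := by
    intro e
    induction e with
    | h a b =>
      intro h
      rcases (mem_edgeSet _).1 h with ⟨h1, h2⟩ | ⟨h1, h2, h3⟩ | ⟨h1, h2, h3⟩
      · exact Or.inl ⟨h2, a, b, rfl, h1⟩
      · exact Or.inr ⟨a, ⟨h1, h3⟩, by rw [h2]⟩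
      · exact Or.inr ⟨b, ⟨h1, h3⟩, by rw [h2]; exact Sym2.eq_swap⟩
  have h2 : N ∪ (fun x => s(x, w)) '' X ⊆ T.edgeSet := by
    rintro e (he | ⟨x, hx, rfl⟩)
    · exact he.1
    · exact hx.2
  have h3 : Disjoint N ((fun x => s(x, w)) '' X) := by
    rw [Set.disjoint_left]
    rintro e ⟨_, a, b, rfl, hab⟩ ⟨x, hx, hxe⟩
    rcases Sym2.eq_iff.1 hxe with ⟨rfl, rfl⟩ | ⟨rfl, rfl⟩
    · exact hw (hab.1 hx.1)
    · exact hw (hab.2 hx.1)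
  have h4 : ((fun x => s(x, w)) '' X).ncard = X.ncard := by
    apply Set.ncard_image_of_injective
    intro a b hab
    exact Sym2.congr_left.1 hab
  have h5 := Set.ncard_le_ncard h1 (Set.toFinite _)
  have h6 := Set.ncard_union_le N ((fun x => s(x, v)) '' X)
  have h7 := Set.ncard_image_le (f := fun x => s(x, v)) (Set.toFinite X)
  have h8 := Set.ncard_le_ncard h2 (Set.toFinite _)
  rw [Set.ncard_union_eq h3 (Set.toFinite _) (Set.toFinite _), h4] at h8
  omega

open Classical in
lemma mv_tot [Fintype V] {T : SimpleGraph V} (hT : T.Connected) {S : Set V} {w v : V}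
    (hw : w ∉ S) (hv : v ∉ S) (hS : ∀ x ∈ S, ∀ y ∉ S, T.Adj x y → y = w) :
    tot (mv T S w v hv) ≤ tot T + 2 * (Fintype.card S : ℤ) *
      (D T v - D T w - (Fintype.card S : ℤ) * T.dist v w) := by
  set d : V → ℤ := fun y => (T.dist v y : ℤ) - T.dist w y with hd
  have hpt : ∀ x y, ((mv T S w v hv).dist x y : ℤ) ≤ T.dist x y +
      ((if x ∈ S then 1 else 0) * (if y ∈ S then 0 else d y) +
       (if y ∈ S then 1 else 0) * (if x ∈ S then 0 else d x)) := by
    intro x y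
    by_cases hx : x ∈ S <;> by_cases hy : y ∈ S <;> simp only [hx, hy, if_true, if_false]
    · have := mv_in hT hw hv hS hx hy
      omega
    · have h1 := mv_cross hT hw hv hS hx hy
      have h2 := dist_cross hT hS hx hy
      simp only [hd]
      omega
    · have h1 := mv_cross hT hw hv hS hy hx
      have h2 := dist_cross hT hS hy hx
      rw [SimpleGraph.dist_comm (u := x), SimpleGraph.dist_comm (u := x)]
      simp only [hd]
      omega
    · have := (mv_out hT hw hv hS hx hy).2
      omega
  have hcard : ∑ x, (if x ∈ S then (1:ℤ) else 0) = Fintype.card S := by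
    rw [Finset.sum_boole, Fintype.card_subtype]
  have hsum : ∑ y, (if y ∈ S then 0 else d y) = D T v - D T w - (Fintype.card S : ℤ) * T.dist v w := by
    rw [← hcard, Finset.sum_mul]
    unfold D
    rw [← Finset.sum_sub_distrib, ← Finset.sum_sub_distrib]
    apply Finset.sum_congr rfl
    intro y _
    by_cases hy : y ∈ S <;> simp only [hy, if_true, if_false]
    · have h1 := dist_cross hT hS hy hv
      rw [T.dist_comm (u := v) (v := y), T.dist_comm (u := w), T.dist_comm (u := v), h1]
      push_cast; ring
    · simp only [hd]; ring
  unfold tot D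
  calc _ ≤ ∑ x, ∑ y, ((T.dist x y : ℤ) +
      ((if x ∈ S then 1 else 0) * (if y ∈ S then 0 else d y) +
       (if y ∈ S then 1 else 0) * (if x ∈ S then 0 else d x))) :=
        Finset.sum_le_sum fun x _ => Finset.sum_le_sum fun y _ => hpt x y
    _ = _ := by
      simp only [Finset.sum_add_distrib, ← Finset.mul_sum, ← Finset.sum_mul, hsum, hcard]
      unfold D
      ring

lemma mv_le {G T : SimpleGraph V} (hTG : T ≤ G) {S : Set V} {w v : V} (hv : v ∉ S)
    (hG : ∀ x ∈ S, T.Adj x w → G.Adj x v) : mv T S w v hv ≤ G := by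
  intro x y h
  rcases h with ⟨h1, h2⟩ | ⟨h1, rfl, h3⟩ | ⟨h1, rfl, h3⟩
  · exact hTG h2
  · exact hG _ h1 h3
  · exact (hG _ h1 h3).symm

open Classical in
/-- moving from a MAD tree cannot improve -/
lemma mad_move [Fintype V] {G T : SimpleGraph V} (hT : IsMADTree G T) {S : Set V} {w v : V}
    (hw : w ∉ S) (hv : v ∉ S) (hS : ∀ x ∈ S, ∀ y ∉ S, T.Adj x y → y = w)
    (hG : ∀ x ∈ S, T.Adj x w → G.Adj x v) (hne : S.Nonempty) :
    (Fintype.card S : ℤ) * T.dist v w ≤ D T v - D T w ∧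
    (D T v - D T w ≤ (Fintype.card S : ℤ) * T.dist v w → IsMADTree G (mv T S w v hv)) := by
  have hsp : IsSpanningTree G (mv T S w v hv) := ⟨mv_le hT.1.1 hv hG, mv_isTree hT.1.2 hw hv hS⟩
  have hmin := hT.2 _ hsp
  have ht := mv_tot hT.1.2.connected hw hv hS
  have e1 := wiener_eq T
  have e2 := wiener_eq (mv T S w v hv)
  have hpos : 0 < (Fintype.card S : ℤ) := by
    have := hne.to_subtype
    exact_mod_cast Fintype.card_pos
  constructor
  · by_contra hlt
    push Not at hlt
    have : (Fintype.card S : ℤ) * (D T v - D T w - (Fintype.card S : ℤ) * T.dist v w) ≤ -1 := by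
      nlinarith
    rw [mul_assoc] at ht
    omega
  · intro hle
    refine ⟨hsp, fun T' hT' => le_trans ?_ (hT.2 T' hT')⟩
    have : (Fintype.card S : ℤ) * (D T v - D T w - (Fintype.card S : ℤ) * T.dist v w) ≤ 0 := by
      nlinarith
    rw [mul_assoc] at ht
    omega

end MadAux

namespace MadAux

variable {V : Type*} [Fintype V]

/-- internal vertices -/
def Intl (T : SimpleGraph V) (x : V) : Prop := ∃ a b, a ≠ b ∧ T.Adj x a ∧ T.Adj x b

lemma intl_iff (T : SimpleGraph V) (x : V) : 2 ≤ (T.neighborSet x).ncard ↔ Intl T x := by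
  have := Set.one_lt_ncard (s := T.neighborSet x) (Set.toFinite _)
  rw [Nat.succ_le_iff, this]
  constructor
  · rintro ⟨a, ha, b, hb, h⟩
    exact ⟨a, b, h, ha, hb⟩
  · rintro ⟨a, b, h, ha, hb⟩
    exact ⟨a, ha, b, hb, h⟩

/-- an internal vertex has a neighbour different from a given vertex -/
lemma Intl.other {T : SimpleGraph V} {x : V} (h : Intl T x) (p : V) :
    ∃ a, T.Adj x a ∧ a ≠ p := by
  obtain ⟨a, b, hab, ha, hb⟩ := h
  by_cases hap : a = p
  · exact ⟨b, hb, fun hbp => hab (hap.trans hbp.symm)⟩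
  · exact ⟨a, ha, hap⟩

lemma mad_move_lt {G T : SimpleGraph V} (hT : IsMADTree G T) {S : Set V} {w v : V}
    (hw : w ∉ S) (hv : v ∉ S) (hS : ∀ x ∈ S, ∀ y ∉ S, T.Adj x y → y = w)
    (hG : ∀ x ∈ S, T.Adj x w → G.Adj x v) (hne : S.Nonempty) (hvw : v ≠ w) : D T w < D T v := by
  classical
  have h1 := (mad_move hT hw hv hS hG hne).1
  have h2 : 0 < (T.dist v w : ℤ) := by
    exact_mod_cast hT.1.2.connected.pos_dist_of_ne hvw
  have h3 : 0 < (Fintype.card S : ℤ) := by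
    have := hne.to_subtype
    exact_mod_cast Fintype.card_pos
  have h4 := lt_of_lt_of_le (mul_pos h3 h2) h1
  omega

lemma fact1 {G T : SimpleGraph V} (hT : IsMADTree G T) {w x v : V} (hwx : T.Adj w x)
    (hd : T.dist w v < T.dist x v) (hG : G.Adj x v) (hne : w ≠ v) : D T w < D T v := by
  classical
  have htree := hT.1.2
  have hS : ∀ a ∈ {y | T.dist y x < T.dist y w}, ∀ b ∉ {y | T.dist y x < T.dist y w},
      T.Adj a b → a = x ∧ b = w := by
    intro a ha b hb hab
    simp only [Set.mem_ofPred_eq] at ha hb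
    have h1 := adj_cases htree hwx b
    simp only [T.dist_comm (v := b)] at h1
    exact cut_edge htree hwx.symm hab ha (by omega)
  have hwS : w ∉ {y | T.dist y x < T.dist y w} := by simp
  have hvS : v ∉ {y | T.dist y x < T.dist y w} := by
    simp only [Set.mem_ofPred_eq, T.dist_comm (u := v)]
    omega
  have hne' : ({y | T.dist y x < T.dist y w} : Set V).Nonempty :=
    ⟨x, by simp [dist_adj hwx.symm]⟩
  refine mad_move_lt hT hwS hvS (fun a ha b hb hab => (hS a ha b hb hab).2) ?_ hne' hne.symm
  intro a ha hab
  rw [(hS a ha w hwS hab).1]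
  exact hG

/-- All neighbours of the worse of two internal vertices of a module are in the module. -/
lemma nbrs_in {G T : SimpleGraph V} (hT : IsMADTree G T) {M : Set V} (hM : IsModule G M)
    {u v : V} (hu : u ∈ M) (hv : v ∈ M) (huv : u ≠ v) (hui : Intl T u) (hD : D T v ≤ D T u) :
    ∀ x, T.Adj u x → x ∈ M := by
  have htree := hT.1.2
  have full : ∀ {z m m' : V}, z ∉ M → m ∈ M → m' ∈ M → G.Adj z m → G.Adj z m' := by
    intro z m m' hz hm hm' h
    rcases hM z hz with h1 | h1
    · exact h1 _ hm'
    · exact absurd h (h1 _ hm)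
  obtain ⟨p, hp, hpv⟩ := exists_toward htree huv
  have off : ∀ x, T.Adj u x → x ≠ p → x ∈ M := by
    intro x hx hxp
    by_contra hxM
    have h1 : ¬ T.dist x v < T.dist u v := fun h => hxp (toward_unique htree hx hp h hpv)
    have h2 := adj_cases htree hx v
    have := fact1 hT hx (v := v) (by omega) (full hxM hu hv (hT.1.1 hx).symm) huv
    omega
  intro x hx
  by_cases hxp : x = p
  · subst hxp
    by_contra hxM
    obtain ⟨y, hy, hyx⟩ := hui.other x
    have hyM := off y hy hyx
    have h2 := dist_two htree hy hx hyx
    have h3 := dist_adj hx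
    have h4 := fact1 hT hy (v := x) (by omega) (full hxM hu hyM (hT.1.1 hx).symm).symm hx.ne
    have h5 := D_mono htree v _ u x rfl hx hpv h4.le (by rintro rfl; exact hxM hv)
    omega
  · exact off x hx hxp

/-- Walking from `u` to `z`, the first exit from `M`. -/
lemma leave_module {T : SimpleGraph V} (htree : T.IsTree) {M : Set V} {u : V} (hu : u ∈ M)
    (hui : Intl T u) (hnb : ∀ x, T.Adj u x → x ∈ M) : ∀ (n : ℕ) (z0 : V), T.dist z0 u = n → z0 ∉ M →
    ∃ v r z, v ∈ M ∧ r ∈ M ∧ z ∉ M ∧ T.Adj r v ∧ T.Adj r z ∧ Intl T v ∧ (z = z0 ∨ Intl T z) := by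
  intro n
  induction n using Nat.strong_induction_on with
  | _ n ih =>
    intro z0 hz hzM
    have hzu : z0 ≠ u := by rintro rfl; exact hzM hu
    obtain ⟨y, hy, hyu⟩ := exists_toward htree hzu
    have step : ∀ t s : V, T.Adj t s → T.dist s u < T.dist t u → s ≠ u → Intl T s := by
      intro t s hts hd hsu
      obtain ⟨q, hq, hqd⟩ := exists_toward htree hsu
      exact ⟨t, q, by rintro rfl; omega, hts.symm, hq⟩
    by_cases hyM : y ∈ M
    · have hyne : y ≠ u := by rintro rfl; exact hzM (hnb _ hy.symm)
      obtain ⟨x, hx, hxu⟩ := exists_toward htree hyne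
      by_cases hxM : x ∈ M
      · refine ⟨x, y, z0, hxM, hyM, hzM, hx, hy.symm, ?_, Or.inl rfl⟩
        by_cases hxe : x = u
        · rw [hxe]; exact hui
        · exact step y x hx hxu hxe
      · obtain ⟨v, r, z, h1, h2, h3, h4, h5, h6, h7⟩ := ih _ (by omega) x rfl hxM
        have := step y x hx hxu (by rintro rfl; exact hxM hu)
        refine ⟨v, r, z, h1, h2, h3, h4, h5, h6, Or.inr ?_⟩
        rcases h7 with rfl | h7
        · exact this
        · exact h7
    · obtain ⟨v, r, z, h1, h2, h3, h4, h5, h6, h7⟩ := ih _ (by omega) y rfl hyM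
      have := step z0 y hy hyu (by rintro rfl; exact hyM hu)
      refine ⟨v, r, z, h1, h2, h3, h4, h5, h6, Or.inr ?_⟩
      rcases h7 with rfl | h7
      · exact this
      · exact h7

lemma final_move {G T : SimpleGraph V} (hT : IsMADTree G T) {M : Set V} (hM : IsModule G M)
    {v r z : V} (hv : v ∈ M) (hr : r ∈ M) (hz : z ∉ M) (hrv : T.Adj r v) (hrz : T.Adj r z)
    (hvi : Intl T v) : ¬ Intl T z ∧ ∃ T', IsMADTree G T' ∧ Intl T' z ∧
      ∀ y, y ≠ z → Intl T' y → Intl T y := by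
  classical
  have htree := hT.1.2
  have full : ∀ {z m m' : V}, z ∉ M → m ∈ M → m' ∈ M → G.Adj z m → G.Adj z m' := by
    intro z m m' hz hm hm' h
    rcases hM z hz with h1 | h1
    · exact h1 _ hm'
    · exact absurd h (h1 _ hm)
  have hvz : v ≠ z := by rintro rfl; exact hz hv
  have hzG : ∀ m ∈ M, G.Adj z m := fun m hm => full hz hr hm (hT.1.1 hrz).symm
  have dzv := dist_two htree hrz hrv hvz.symm
  have drv := dist_adj hrv
  have drz := dist_adj hrz
  have hDr : D T r < D T v := fact1 hT hrz (v := v) (by omega) (hzG v hv) hrv.ne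
  have hnb : ∀ y, T.Adj v y → y ≠ r → y ∈ M := by
    intro y hy hyr
    by_contra hyM
    have h1 := dist_two htree hy hrv.symm hyr
    have h2 := dist_adj hrv.symm
    have := fact1 hT hy (v := r) (by omega) (full hyM hv hr (hT.1.1 hy).symm) hrv.ne.symm
    omega
  obtain ⟨S, hSdef⟩ : ∃ S : Set V, S = {y | y ≠ v ∧ T.dist y v < T.dist y r} := ⟨_, rfl⟩
  have memS : ∀ y, y ∈ S ↔ y ≠ v ∧ T.dist y v < T.dist y r := by
    intro y; rw [hSdef]; rfl
  have hvS : v ∉ S := by simp [memS]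
  have hzS : z ∉ S := by
    rw [memS, T.dist_comm (u := z) (v := r)]; omega
  have hrS : r ∉ S := by simp [memS]
  have hS : ∀ a ∈ S, ∀ b ∉ S, T.Adj a b → b = v := by
    intro a ha b hb hab
    by_contra hbv
    rw [memS] at ha hb
    have h1 := adj_cases htree hrv b
    simp only [T.dist_comm (v := b)] at h1
    have := cut_edge htree hrv.symm hab ha.2 (by
      have : ¬ T.dist b v < T.dist b r := fun h => hb ⟨hbv, h⟩
      omega)
    exact ha.1 this.1
  obtain ⟨s, hs, hsr⟩ := hvi.other r
  have hsS : s ∈ S := by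
    rw [memS]
    refine ⟨hs.ne.symm, ?_⟩
    rw [dist_two htree hs hrv.symm hsr, dist_adj hs.symm]
    omega
  have hmove := mad_move hT hvS hzS hS (by
    intro a ha hav
    refine (hzG a (hnb a hav.symm ?_)).symm
    rintro rfl
    exact hrS ha) ⟨s, hsS⟩
  rw [dzv] at hmove
  -- the estimate for `D z - D v`
  have hcard : ∑ x, (if x ∈ S then (2:ℤ) else 0) = (Fintype.card S : ℤ) * 2 := by
    rw [← Finset.sum_filter, Finset.sum_const, Fintype.card_subtype]
    simp
  have hest : ∀ Z : Finset V, (∀ y ∈ Z, T.dist y z < T.dist y r) →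
      D T z + ∑ y, (if y ∈ Z then (2:ℤ) else 0) ≤
        D T v + ((Fintype.card S : ℤ) * 2 + 2) := by
    intro Z hZ
    have h2 : (2:ℤ) = ∑ y, (if y = v then (2:ℤ) else 0) := by simp
    rw [← hcard]
    nth_rw 3 [h2]
    unfold D
    rw [← Finset.sum_add_distrib, ← Finset.sum_add_distrib, ← Finset.sum_add_distrib]
    apply Finset.sum_le_sum
    intro y _
    have h1 := adj_cases htree hrv y
    have h2 := adj_cases htree hrz y
    have h3 := memS y
    have h4 := hZ y
    have h5 : ¬ (T.dist v y < T.dist r y ∧ T.dist z y < T.dist r y) :=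
      fun hh => hvz (toward_unique htree hrv hrz hh.1 hh.2)
    by_cases hyr : y = r
    · subst hyr
      simp only [T.dist_comm (v := y)] at *
      have : y ∉ Z := fun h => by have := h4 h; simp at this
      simp only [hrS, this, if_false, hrv.ne]
      omega
    simp only [T.dist_comm (u := y)] at h3 h4
    by_cases hyS : y ∈ S
    · have h6 := (h3.1 hyS)
      have h7 : y ∉ Z := fun h => h5 ⟨h6.2, h4 h⟩
      simp only [hyS, h7, h6.1, if_true, if_false]
      omega
    · by_cases hyv : y = v
      · subst hyv
        have h7 : y ∉ Z := fun h => by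
          have := h4 h
          rw [T.dist_comm (u := z)] at this
          rw [T.dist_comm (u := z)] at dzv
          omega
        simp only [hyS, h7, if_true, if_false]
        omega
      · have h8 : ¬ T.dist v y < T.dist r y := fun h => hyS (h3.2 ⟨hyv, h⟩)
        by_cases hyZ : y ∈ Z
        · have := h4 hyZ
          simp only [hyS, hyZ, hyv, if_true, if_false]
          omega
        · simp only [hyS, hyZ, hyv, if_false]
          omega
  constructor
  · intro hzi
    obtain ⟨t, ht, htr⟩ := hzi.other r
    have h1 := hest {z, t} (by
      intro y hy
      rcases (by simpa using hy : y = z ∨ y = t) with rfl | rfl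
      · rw [T.dist_comm (v := r), drz]; simp
      · rw [dist_two htree ht hrz.symm htr, dist_adj ht.symm]; omega)
    have h2 : ∑ y, (if y ∈ ({z, t} : Finset V) then (2:ℤ) else 0) = 4 := by
      rw [← Finset.sum_filter, Finset.sum_const]
      have : (Finset.univ.filter fun y => y ∈ ({z, t} : Finset V)) = {z, t} := by
        ext; simp
      rw [this, Finset.card_pair ht.ne]
      norm_num
    have := hmove.1
    push_cast at this
    omega
  · have h1 := hest {z} (by
      intro y hy
      rw [Finset.mem_singleton] at hy
      subst hy
      rw [T.dist_comm (v := r), drz]; simp)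
    have h2 : ∑ y, (if y ∈ ({z} : Finset V) then (2:ℤ) else 0) = 2 := by simp
    refine ⟨_, hmove.2 (by push_cast; omega), ?_, ?_⟩
    · refine ⟨r, s, hsr.symm, Or.inl ⟨by simp [hzS, hrS], hrz.symm⟩, ?_⟩
      exact Or.inr (Or.inr ⟨hsS, rfl, hs.symm⟩)
    · rintro y hyz ⟨a, b, hab, ha, hb⟩
      by_cases hyS : y ∈ S
      · have conv : ∀ c, (mv T S v z hzS).Adj y c → (c ∈ S ∧ T.Adj y c) ∨ (c = z ∧ T.Adj y v) := by
          rintro c (⟨h1, h2⟩ | ⟨h1, h2, h3⟩ | ⟨h1, h2, h3⟩)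
          · exact Or.inl ⟨h1.1 hyS, h2⟩
          · exact Or.inr ⟨h2, h3⟩
          · exact absurd h2 hyz
        rcases conv a ha with ⟨h1, h2⟩ | ⟨h1, h2⟩ <;> rcases conv b hb with ⟨h3, h4⟩ | ⟨h3, h4⟩
        · exact ⟨a, b, hab, h2, h4⟩
        · exact ⟨a, v, fun e => hvS (e ▸ h1), h2, h4⟩
        · exact ⟨v, b, fun e => hvS (e ▸ h3), h2, h4⟩
        · exact absurd (h1.trans h3.symm) hab
      · have conv : ∀ c, (mv T S v z hzS).Adj y c → T.Adj y c := by
          rintro c (⟨h1, h2⟩ | ⟨h1, h2, h3⟩ | ⟨h1, h2, h3⟩)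
          · exact h2
          · exact absurd h1 hyS
          · exact absurd h2 hyz
        exact ⟨a, b, hab, conv a ha, conv b hb⟩

lemma key_lemma {G T : SimpleGraph V} (hT : IsMADTree G T) {M : Set V} (hM : IsModule G M)
    {u v : V} (hu : u ∈ M) (hv : v ∈ M) (huv : u ≠ v) (hui : Intl T u) (hvi : Intl T v)
    (z0 : V) (hz0 : z0 ∉ M) : ¬ Intl T z0 ∧ ∃ T', IsMADTree G T' ∧ Intl T' z0 ∧
      ∀ y, y ≠ z0 → Intl T' y → Intl T y := by
  obtain ⟨c, hc, hci, hcn⟩ : ∃ c, c ∈ M ∧ Intl T c ∧ ∀ x, T.Adj c x → x ∈ M := by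
    rcases le_total (D T v) (D T u) with h | h
    · exact ⟨u, hu, hui, nbrs_in hT hM hu hv huv hui h⟩
    · exact ⟨v, hv, hvi, nbrs_in hT hM hv hu huv.symm hvi h⟩
  obtain ⟨v', r, z, h1, h2, h3, h4, h5, h6, h7⟩ := leave_module hT.1.2 hc hci hcn _ z0 rfl hz0
  have hf := final_move hT hM h1 h2 h3 h4 h5 h6
  rcases h7 with rfl | h7
  · exact hf
  · exact absurd h7 hf.1

lemma exists_mad {G : SimpleGraph V} (hG : G.Connected) : ∃ T, IsMADTree G T := by
  classical
  obtain ⟨T0, h1, h2⟩ := hG.exists_isTree_le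
  have hex : ∃ n, ∃ T, IsSpanningTree G T ∧ wiener T = n := ⟨_, T0, ⟨h1, h2⟩, rfl⟩
  obtain ⟨T, hT, hn⟩ := Nat.find_spec hex
  refine ⟨T, hT, fun T' hT' => ?_⟩
  rw [hn]
  exact Nat.find_min' hex ⟨T', hT', rfl⟩

end MadAux

theorem stmt3 {V : Type*} [Fintype V] (G : SimpleGraph V) (hG : G.Connected)
    {k : ℕ} (M : Fin k → Set V) (hM : IsModularPartition G M) :
    ∃ T : SimpleGraph V, IsMADTree G T ∧ IsPolyStar T M := by
  obtain ⟨T, hT⟩ := MadAux.exists_mad hG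
  by_cases hps : IsPolyStar T M
  · exact ⟨T, hT, hps⟩
  unfold IsPolyStar at hps
  push Not at hps
  obtain ⟨j, u, hu, v, hv, hui, hvi, huv⟩ := hps
  rw [MadAux.intl_iff] at hui hvi
  obtain ⟨hk, hne, hmod, hdisj, -⟩ := hM
  have hmain := MadAux.key_lemma hT (hmod j) hu hv huv hui hvi
  obtain ⟨i, hij⟩ : ∃ i : Fin k, i ≠ j := by
    have : Nontrivial (Fin k) := Fin.nontrivial_iff_two_le.2 hk
    exact exists_ne j
  obtain ⟨z, hz⟩ := hne i
  have hzj : z ∉ M j := Set.disjoint_left.1 (hdisj hij) hz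
  obtain ⟨-, T', hT', hzi, himp⟩ := hmain z hzj
  refine ⟨T', hT', ?_⟩
  intro l a ha b hb hai hbi
  rw [MadAux.intl_iff] at hai hbi
  by_contra hab
  by_cases hlj : l = j
  · subst hlj
    exact (MadAux.key_lemma hT' (hmod l) ha hb hab hai hbi z hzj).1 hzi
  · have key : ∀ c ∈ M l, MadAux.Intl T' c → c = z := by
      intro c hc hci
      by_contra hcz
      exact (hmain c (Set.disjoint_left.1 (hdisj hlj) hc)).1 (himp c hcz hci)
    exact hab ((key a ha hai).trans (key b hb hbi).symm)
end

section
/- Let G be a finite connected simple graph with a modular partition P = {M_1, …, M_k} into k ≥ 2 modules. Let T be a poly-star MAD tree of G with root r ∈ M_i, and for each j ∈ {1,…,k} let d_j ∈ M_j be a vertex of maximum degree in T among the vertices of M_j, with d_i = r; set D := {d_1, …, d_k}. Then the subgraph of T induced on D is a tree. -/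
open SimpleGraph

/-- An interior vertex of a path has at least two neighbours. -/
lemma two_le_ncard_of_interior {V : Type*} [Fintype V] {T : SimpleGraph V} {u v : V}
    (p : T.Walk u v) (hp : p.IsPath) : ∀ w ∈ p.support, w ≠ u → w ≠ v →
      2 ≤ (T.neighborSet w).ncard := by
  induction p with
  | nil =>
    intro w hw h1 _
    simp at hw
    exact absurd hw h1
  | @cons a b c h q ih =>
    intro w hw h1 h2
    rw [Walk.cons_isPath_iff] at hp
    rw [Walk.support_cons, List.mem_cons] at hw
    rcases hw with hw | hw
    · exact absurd hw h1
    by_cases hwb : w = b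
    · subst hwb
      cases q with
      | nil => exact absurd rfl h2
      | @cons _ e _ h' q' =>
        have hne : a ≠ e := by
          rintro rfl
          exact hp.2 (by simp)
        calc 2 = ({a, e} : Set V).ncard := (Set.ncard_pair hne).symm
          _ ≤ _ := Set.ncard_le_ncard (by
            rintro x (rfl | rfl)
            · exact h.symm
            · exact h') (Set.toFinite _)
    · exact ih hp.1 w hw hwb h2

theorem stmt4 {V : Type*} [Fintype V] (G : SimpleGraph V) (hG : G.Connected)
    {k : ℕ} (M : Fin k → Set V) (hM : IsModularPartition G M)
    (T : SimpleGraph V) (hT : IsMADTree G T) (hps : IsPolyStar T M)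
    (i : Fin k) (r : V) (hr : r ∈ M i) (hroot : IsRoot G T r)
    (d : Fin k → V) (hd : ∀ j, d j ∈ M j)
    (hdmax : ∀ j, ∀ v ∈ M j, (T.neighborSet v).ncard ≤ (T.neighborSet (d j)).ncard)
    (hdi : d i = r) :
    (T.induce (Set.range d)).IsTree := by
  obtain ⟨⟨_, hTree⟩, _⟩ := hT
  obtain ⟨_, _, _, _, hcov⟩ := hM
  have hdeg : ∀ w, 2 ≤ (T.neighborSet w).ncard → w ∈ Set.range d := by
    intro w hw
    have hwu : w ∈ ⋃ j, M j := by rw [hcov]; trivial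
    obtain ⟨j, hj⟩ := Set.mem_iUnion.mp hwu
    exact ⟨j, hps j _ (hd j) _ hj (hw.trans (hdmax j w hj)) hw⟩
  have : Nonempty (Set.range d) := ⟨⟨d i, i, rfl⟩⟩
  refine ⟨⟨?_⟩, hTree.isAcyclic.induce _⟩
  rintro ⟨u, hu⟩ ⟨v, hv⟩
  obtain ⟨p, hp⟩ := hTree.isConnected.exists_isPath u v
  have hs : ∀ x ∈ p.support, x ∈ Set.range d := by
    intro x hx
    by_cases h1 : x = u
    · exact h1 ▸ hu
    by_cases h2 : x = v
    · exact h2 ▸ hv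
    exact hdeg x (two_le_ncard_of_interior p hp x hx h1 h2)
  exact ⟨p.induce _ hs⟩
end

section
/- Let G be a finite connected simple graph with a modular partition P = {M_1, …, M_k} into k ≥ 2 modules. Let T be a poly-star MAD tree of G with root r ∈ M_i, and for each j let d_j ∈ M_j be a vertex of maximum degree in T among the vertices of M_j, with d_i = r; set D := {d_1, …, d_k}. Then for every non-root module M_j with j ≠ i and every vertex v ∈ M_j \ {d_j}, the T-neighborhood of v is N_T(v) = {c_j}, where c_j is the unique vertex lying both on the path from r to d_j in the tree T[D] induced on D and in N_T(d_j). -/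
open SimpleGraph

theorem acyc_path_eq {V : Type*} {T : SimpleGraph V} (h : T.IsAcyclic) {a b : V}
    {p q : T.Walk a b} (hp : p.IsPath) (hq : q.IsPath) : p = q := by
  have := (h.subsingleton_path a b).elim ⟨p, hp⟩ ⟨q, hq⟩
  exact congrArg Subtype.val this

theorem acyc_dist_eq {V : Type*} {T : SimpleGraph V} (h : T.IsAcyclic) {a b : V}
    (p : T.Walk a b) (hp : p.IsPath) : T.dist a b = p.length := by
  obtain ⟨q, hq, hl⟩ := (p.reachable).exists_path_of_dist
  have h2 : p = q := acyc_path_eq h hp hq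
  rw [h2, hl]

theorem sub_dist_eq {V : Type*} {F T : SimpleGraph V} (hT : T.IsAcyclic) (hle : F ≤ T)
    {a b : V} (hab : F.Reachable a b) : T.dist a b = F.dist a b := by
  obtain ⟨q, hq, hl⟩ := hab.exists_path_of_dist
  rw [acyc_dist_eq hT (q.mapLe hle) (hq.mapLe hle)]
  simpa using hl

theorem cross_dist_eq {V : Type*} {F T : SimpleGraph V} (hT : T.IsAcyclic) (hle : F ≤ T)
    {x p a b : V} (hxp : T.Adj x p) (hn : ¬ F.Reachable x p)
    (ha : F.Reachable a x) (hb : F.Reachable p b) :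
    T.dist a b = F.dist a x + 1 + F.dist p b := by
  obtain ⟨q, hq, hl⟩ := ha.exists_path_of_dist
  obtain ⟨q', hq', hl'⟩ := hb.exists_path_of_dist
  have hpath : ((q.mapLe hle).append (Walk.cons hxp (q'.mapLe hle))).IsPath := by
    rw [Walk.isPath_def, Walk.support_append]
    simp only [Walk.support_cons, List.tail_cons, Walk.support_mapLe_eq_support]
    rw [List.nodup_append]
    refine ⟨hq.support_nodup, hq'.support_nodup, ?_⟩
    rintro y hy z hz rfl
    classical
    exact hn (((q.dropUntil y hy).reachable.symm).trans (q'.takeUntil y hz).reachable.symm)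
  rw [acyc_dist_eq hT _ hpath]
  simp
  omega

theorem reach_or {V : Type*} {T : SimpleGraph V} (hT : T.Connected) {x p : V} (b : V) :
    (T.deleteEdges {s(x, p)}).Reachable x b ∨ (T.deleteEdges {s(x, p)}).Reachable p b := by
  obtain ⟨w⟩ := hT.preconnected b x
  have : ∀ {c d : V} (w : T.Walk c d), d = x →
      (T.deleteEdges {s(x, p)}).Reachable x c ∨ (T.deleteEdges {s(x, p)}).Reachable p c := by
    intro c d w
    induction w with
    | nil => rintro rfl; exact Or.inl (Reachable.refl _)
    | @cons u v w h q ih =>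
      intro hd
      by_cases he : s(u, v) = s(x, p)
      · rw [Sym2.eq_iff] at he
        rcases he with ⟨rfl, rfl⟩ | ⟨rfl, rfl⟩
        · exact Or.inl (Reachable.refl _)
        · exact Or.inr (Reachable.refl _)
      · have hadj : (T.deleteEdges {s(x, p)}).Adj v u := by
          rw [deleteEdges_adj]
          refine ⟨h.symm, ?_⟩
          rw [Set.mem_singleton_iff]; exact fun h => he (Sym2.eq_swap.trans h)
        rcases ih hd with h1 | h1
        · exact Or.inl (h1.trans hadj.reachable)
        · exact Or.inr (h1.trans hadj.reachable)
  exact this w rfl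

theorem not_reach {V : Type*} {T : SimpleGraph V} (hT : T.IsAcyclic) {x p : V}
    (h : T.Adj x p) : ¬ (T.deleteEdges {s(x, p)}).Reachable x p := by
  have := isAcyclic_iff_forall_isBridge.1 hT (e := s(x, p)) h
  exact isBridge_iff.1 this

theorem exchange {V : Type*} [Fintype V] {G T : SimpleGraph V} (hT : IsMADTree G T)
    {x p q : V} (hxp : T.Adj x p) (hq : (T.deleteEdges {s(x, p)}).Reachable p q)
    (hxq : G.Adj x q) (S : Finset V)
    (hS : ∀ b, b ∈ S ↔ (T.deleteEdges {s(x, p)}).Reachable p b) :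
    ∑ b ∈ S, T.dist p b ≤ ∑ b ∈ S, T.dist q b := by
  classical
  obtain ⟨⟨hTG, hTT⟩, hmin⟩ := hT
  have hac := hTT.isAcyclic
  have hnr := not_reach hac hxp
  set F := T.deleteEdges {s(x, p)} with hF
  have hFT : F ≤ T := deleteEdges_le _
  have hnq : ¬ F.Reachable x q := fun h => hnr (h.trans hq.symm)
  set T' := F ⊔ edge x q with hT'
  have hFT' : F ≤ T' := le_sup_left
  have hadj' : T'.Adj x q := by
    rw [hT', sup_adj]; right; rw [edge_adj]; exact ⟨Or.inl ⟨rfl, rfl⟩, hxq.ne⟩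
  have hac' : T'.IsAcyclic := IsAcyclic.sup_edge_of_not_reachable hnq (hac.anti hFT)
  have hcompl : ∀ b, b ∉ S → F.Reachable b x := by
    intro b hb
    rcases reach_or hTT.connected (x := x) (p := p) b with h | h
    · exact h.symm
    · exact absurd ((hS b).2 h) hb
  have hst : IsSpanningTree G T' := by
    refine ⟨sup_le (hFT.trans hTG) ?_, ?_, hac'⟩
    · intro a b hab
      rw [edge_adj] at hab
      rcases hab with ⟨⟨rfl, rfl⟩ | ⟨rfl, rfl⟩, _⟩
      · exact hxq
      · exact hxq.symm
    · have : Nonempty V := ⟨x⟩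
      have hx : ∀ b, T'.Reachable x b := by
        intro b
        by_cases hb : b ∈ S
        · exact hadj'.reachable.trans ((hq.symm.trans ((hS b).1 hb)).mono hFT')
        · exact ((hcompl b hb).symm).mono hFT'
      exact Connected.mk (fun a b => (hx a).symm.trans (hx b))
  have hW := hmin T' hst
  have hxS : x ∈ Sᶜ := by
    rw [Finset.mem_compl, hS]; exact fun h => hnr h.symm
  -- decomposition
  have key : ∀ (H : SimpleGraph V) (z : V), H.IsAcyclic → F ≤ H → H.Adj x z → F.Reachable p z →
      ∑ u : V, ∑ v : V, H.dist u v =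
        (∑ u ∈ S, ∑ v ∈ S, F.dist u v + ∑ u ∈ Sᶜ, ∑ v ∈ Sᶜ, F.dist u v)
        + 2 * (∑ u ∈ Sᶜ, ∑ v ∈ S, (F.dist u x + 1) + Sᶜ.card * ∑ v ∈ S, H.dist z v) := by
    intro H z hH hFH hxz hpz
    have hnz : ¬ F.Reachable x z := fun h => hnr (h.trans hpz.symm)
    have hcr : ∑ u ∈ Sᶜ, ∑ v ∈ S, H.dist u v =
        ∑ u ∈ Sᶜ, ∑ v ∈ S, (F.dist u x + 1) + Sᶜ.card * ∑ v ∈ S, H.dist z v := by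
      rw [← smul_eq_mul, ← Finset.sum_const, ← Finset.sum_add_distrib]
      refine Finset.sum_congr rfl fun u hu => ?_
      rw [← Finset.sum_add_distrib]
      refine Finset.sum_congr rfl fun v hv => ?_
      have hzv : F.Reachable z v := hpz.symm.trans ((hS v).1 hv)
      rw [cross_dist_eq hH hFH hxz hnz (hcompl u (Finset.mem_compl.1 hu)) hzv,
        sub_dist_eq hH hFH hzv]
    have hcr2 : ∑ u ∈ S, ∑ v ∈ Sᶜ, H.dist u v = ∑ u ∈ Sᶜ, ∑ v ∈ S, H.dist u v := by
      rw [Finset.sum_comm]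
      refine Finset.sum_congr rfl fun u hu => Finset.sum_congr rfl fun v hv => dist_comm
    have hSS : ∑ u ∈ S, ∑ v ∈ S, H.dist u v = ∑ u ∈ S, ∑ v ∈ S, F.dist u v := by
      refine Finset.sum_congr rfl fun u hu => Finset.sum_congr rfl fun v hv => ?_
      exact sub_dist_eq hH hFH (((hS u).1 hu).symm.trans ((hS v).1 hv))
    have hCC : ∑ u ∈ Sᶜ, ∑ v ∈ Sᶜ, H.dist u v = ∑ u ∈ Sᶜ, ∑ v ∈ Sᶜ, F.dist u v := by
      refine Finset.sum_congr rfl fun u hu => Finset.sum_congr rfl fun v hv => ?_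
      exact sub_dist_eq hH hFH ((hcompl u (Finset.mem_compl.1 hu)).trans
        (hcompl v (Finset.mem_compl.1 hv)).symm)
    have hsplit : ∀ f : V → ℕ, ∑ v, f v = ∑ v ∈ S, f v + ∑ v ∈ Sᶜ, f v :=
      fun f => (Finset.sum_add_sum_compl S f).symm
    rw [hsplit]
    simp_rw [hsplit (fun v => H.dist _ v), Finset.sum_add_distrib]
    rw [hcr2, hSS, hCC]
    rw [Finset.sum_congr rfl (fun u _ => Finset.sum_add_distrib (s := S)
      (f := fun _ => F.dist u x) (g := fun _ => 1)), Finset.sum_add_distrib] at hcr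
    rw [hcr]
    ring
  have k1 := key T p hac hFT hxp (Reachable.refl _)
  have k2 := key T' q hac' hFT' hadj' hq
  unfold wiener at hW
  rw [k1, k2] at hW
  have hq2 : ∑ v ∈ S, T'.dist q v = ∑ v ∈ S, T.dist q v := by
    refine Finset.sum_congr rfl fun v hv => ?_
    have hqv : F.Reachable q v := hq.symm.trans ((hS v).1 hv)
    rw [sub_dist_eq hac' hFT' hqv, sub_dist_eq hac hFT hqv]
  rw [hq2] at hW
  have hle : Sᶜ.card * ∑ v ∈ S, T.dist p v ≤ Sᶜ.card * ∑ v ∈ S, T.dist q v := by omega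
  exact Nat.le_of_mul_le_mul_left hle (Finset.card_pos.2 ⟨x, hxS⟩)

theorem exists_concat_path {V : Type*} {T : SimpleGraph V} (hT : T.Connected) {r y : V}
    (hne : y ≠ r) : ∃ (w : V) (q : T.Walk r w) (_ : T.Adj w y), q.IsPath ∧ y ∉ q.support := by
  obtain ⟨p, hp⟩ := (hT.preconnected r y).exists_isPath
  induction p using Walk.concatRec with
  | Hnil => exact absurd rfl hne
  | Hconcat q h _ =>
    exact ⟨_, q, h, (Walk.concat_isPath_iff h).1 hp⟩

theorem two_le_deg {V : Type*} [Fintype V] {T : SimpleGraph V} {r y z : V} {p : T.Walk r y}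
    (hz : z ∉ p.support) (hyz : T.Adj y z) (hne : y ≠ r) :
    2 ≤ (T.neighborSet y).ncard := by
  have hnil : ¬ p.Nil := Walk.not_nil_of_ne hne.symm
  have hadj : T.Adj y p.penultimate := (p.adj_penultimate hnil).symm
  have hne2 : p.penultimate ≠ z := by
    rintro rfl
    exact hz (p.getVert_mem_support _)
  rw [← Set.ncard_pair hne2]
  apply Set.ncard_le_ncard _ (Set.toFinite _)
  rintro u (rfl | rfl)
  · exact hadj
  · exact hyz

theorem path_in_D {V : Type*} [Fintype V] {T : SimpleGraph V} {r : V} {D : Set V} (hr : r ∈ D)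
    (hD : ∀ y, 2 ≤ (T.neighborSet y).ncard → y ∈ D) {y : V} (p : T.Walk r y) (hp : p.IsPath)
    (hy : y ∈ D) : ∀ z ∈ p.support, z ∈ D := by
  induction p using Walk.concatRec with
  | Hnil => simpa using hy
  | @Hconcat a b c q h ih =>
    obtain ⟨hq, hc⟩ := (Walk.concat_isPath_iff h).1 hp
    have hb : b ∈ D := by
      by_cases hba : b = a
      · rw [hba]; exact hr
      · exact hD b (two_le_deg hc h hba)
    intro z hz
    rw [Walk.support_concat, List.mem_append, List.mem_singleton] at hz
    rcases hz with hz | rfl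
    · exact ih hr hq hb z hz
    · exact hy

theorem stmt5 {V : Type*} [Fintype V] (G : SimpleGraph V) (hG : G.Connected)
    {k : ℕ} (M : Fin k → Set V) (hM : IsModularPartition G M)
    (T : SimpleGraph V) (hT : IsMADTree G T) (hps : IsPolyStar T M)
    (i : Fin k) (r : V) (hr : r ∈ M i) (hroot : IsRoot G T r)
    (d : Fin k → V) (hd : ∀ j, d j ∈ M j)
    (hdmax : ∀ j, ∀ v ∈ M j, (T.neighborSet v).ncard ≤ (T.neighborSet (d j)).ncard)
    (hdi : d i = r) :
    ∀ j : Fin k, j ≠ i →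
      ∃ cj : V, ∃ hcj : cj ∈ Set.range d,
        -- `cj` is a `T`-neighbor of `d j`
        T.Adj (d j) cj ∧
        -- `cj` lies on the (unique) path from `r` to `d j` in the tree `T[D]`
        (∀ (hrD : r ∈ Set.range d) (hdjD : d j ∈ Set.range d)
            (p : (T.induce (Set.range d)).Walk ⟨r, hrD⟩ ⟨d j, hdjD⟩), p.IsPath →
            (⟨cj, hcj⟩ : Set.range d) ∈ p.support) ∧
        -- and it is the unique such vertex
        (∀ c' : V, ∀ hc' : c' ∈ Set.range d, T.Adj (d j) c' →
            (∀ (hrD : r ∈ Set.range d) (hdjD : d j ∈ Set.range d)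
              (p : (T.induce (Set.range d)).Walk ⟨r, hrD⟩ ⟨d j, hdjD⟩), p.IsPath →
              (⟨c', hc'⟩ : Set.range d) ∈ p.support) → c' = cj) ∧
        -- every other vertex of `M j` has `T`-neighborhood exactly `{cj}`
        (∀ v ∈ M j, v ≠ d j → T.neighborSet v = {cj}) := by
  classical
  intro j hji
  have hMAD := hT
  obtain ⟨⟨hTG, hTT⟩, -⟩ := hT
  obtain ⟨-, -, hmod, hdisj, hcov⟩ := hM
  have hac := hTT.isAcyclic
  have hD : ∀ y, 2 ≤ (T.neighborSet y).ncard → y ∈ Set.range d := by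
    intro y hy
    have : y ∈ ⋃ l, M l := hcov ▸ Set.mem_univ y
    obtain ⟨l, hl⟩ := Set.mem_iUnion.1 this
    exact ⟨l, (hps l y hl (d l) (hd l) hy (hy.trans (hdmax l y hl))).symm⟩
  have hnotmem : ∀ l v, v ∈ M j → v ∈ M l → l = j := by
    intro l v h1 h2
    by_contra hne
    exact Set.disjoint_left.1 (hdisj hne) h2 h1
  have hnr : ∀ v ∈ M j, v ≠ r := by
    rintro v hv rfl
    exact hji (hnotmem i v hv hr).symm
  have hrD : r ∈ Set.range d := ⟨i, hdi⟩
  have hdjD : d j ∈ Set.range d := ⟨j, rfl⟩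
  obtain ⟨c, q, hc, hq, hdq⟩ := exists_concat_path hTT.connected (hnr (d j) (hd j))
  have hP : (q.concat hc).IsPath := (Walk.concat_isPath_iff hc).2 ⟨hq, hdq⟩
  have hPD := path_in_D hrD hD _ hP hdjD
  have hcP : c ∈ (q.concat hc).support := by
    rw [Walk.support_concat, List.mem_append]; exact Or.inl q.end_mem_support
  have hcD : c ∈ Set.range d := hPD c hcP
  have hcM : c ∉ M j := by
    obtain ⟨l, hl⟩ := hcD
    intro hcj
    have : l = j := hnotmem l c hcj (hl ▸ hd l)
    subst this
    exact hc.ne hl.symm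
  have hcG : ∀ v ∈ M j, G.Adj c v := by
    rcases hmod j c hcM with h | h
    · exact h
    · exact absurd (hTG hc) (h (d j) (hd j))
  refine ⟨c, hcD, hc.symm, ?_, ?_, ?_⟩
  · intro hrD' hdjD' p hp
    have hmp : (p.map (Embedding.induce (Set.range d)).toHom).IsPath :=
      hp.map Subtype.val_injective
    have heq : p.map (Embedding.induce (Set.range d)).toHom = q.concat hc :=
      acyc_path_eq hac hmp hP
    have hm : c ∈ (p.map (Embedding.induce (Set.range d)).toHom).support := by
      rw [heq]; exact hcP
    rw [Walk.support_map, List.mem_map] at hm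
    obtain ⟨z, hz, hzc⟩ := hm
    have : z = ⟨c, hcD⟩ := Subtype.ext hzc
    rwa [← this]
  · intro c' hc' hadj hall
    have hip : ((q.concat hc).induce (Set.range d) hPD).IsPath := by
      apply Walk.IsPath.of_map (f := (Embedding.induce (Set.range d)).toHom)
      rw [Walk.map_induce]
      exact hP
    have h1 := hall hrD hdjD _ hip
    rw [Walk.support_induce] at h1
    have h2 : c' ∈ (q.concat hc).support := by simpa using h1
    have h3 := hac.eq_penultimate_of_adj_end hP hadj h2
    simpa using h3
  · intro v hv hvd
    have hvdeg : (T.neighborSet v).ncard < 2 := by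
      by_contra hcon
      push Not at hcon
      exact hvd (hps j v hv (d j) (hd j) hcon (hcon.trans (hdmax j v hv)))
    obtain ⟨w, s, hw, hs, hvs⟩ := exists_concat_path hTT.connected (hnr v hv)
    have hvN : ∀ u, T.Adj v u → u = w := by
      intro u hu
      exact (Set.ncard_le_one_iff (Set.toFinite _)).1 (Nat.lt_succ_iff.1 hvdeg) hu hw.symm
    have hNv : T.neighborSet v = {w} := by
      ext u
      exact ⟨fun h => hvN u h, fun h => by rw [Set.mem_singleton_iff.1 h]; exact hw.symm⟩
    rw [hNv]
    by_contra hwc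
    have hwc : w ≠ c := fun h => hwc (by rw [h])
    have hQ : (s.concat hw).IsPath := (Walk.concat_isPath_iff hw).2 ⟨hs, hvs⟩
    have hcs : c ∉ s.support := by
      intro hcs
      have := hroot _ hQ c (by rw [Walk.support_concat, List.mem_append]; exact Or.inl hcs)
        v (Walk.end_mem_support _) (hcG v hv)
      exact hwc (hvN c (Walk.adj_of_mem_edges _ this).symm).symm
    have hwM : w ∉ M j := by
      intro hwM
      have h2 := two_le_deg hvs hw (hnr w hwM)
      have hwd : w = d j := hps j w hwM (d j) (hd j) h2 (h2.trans (hdmax j w hwM))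
      subst hwd
      apply hcs
      rw [acyc_path_eq hac hs hP]
      exact hcP
    have hwG : ∀ u ∈ M j, G.Adj w u := by
      rcases hmod j w hwM with h | h
      · exact h
      · exact absurd (hTG hw) (h v hv)
    -- the two exchanges
    have hsame1 : ∀ b, (T.deleteEdges {s(v, w)}).Reachable w b ↔ b ≠ v := by
      intro b
      constructor
      · rintro h rfl
        exact not_reach hac hw.symm h.symm
      · intro hb
        rcases reach_or hTT.connected (x := v) (p := w) b with h | h
        · obtain ⟨t⟩ := h
          cases t with
          | nil => exact absurd rfl hb
          | cons h' _ =>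
            rw [deleteEdges_adj] at h'
            have := hvN _ h'.1
            subst this
            exact absurd rfl h'.2
        · exact h
    have hcv : c ≠ v := fun h => hcM (h ▸ hv)
    have e1 := exchange hMAD hw.symm ((hsame1 c).2 hcv) (hcG v hv).symm
      (Finset.univ.erase v) (by intro b; rw [hsame1]; simp)
    have hreach : (T.deleteEdges {s(d j, c)}).Reachable c w := by
      have h1 : (T.deleteEdges {s(d j, c)}).Reachable r c :=
        reachable_deleteEdges_iff_exists_walk.2
          ⟨q, fun h => hdq (q.fst_mem_support_of_mem_edges h)⟩
      have h2 : (T.deleteEdges {s(d j, c)}).Reachable r w :=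
        reachable_deleteEdges_iff_exists_walk.2
          ⟨s, fun h => hcs (s.snd_mem_support_of_mem_edges h)⟩
      exact h1.symm.trans h2
    set F := T.deleteEdges {s(d j, c)} with hF
    have e2 := exchange hMAD hc.symm hreach (hwG (d j) (hd j)).symm
      (Finset.univ.filter fun b => F.Reachable c b) (by intro b; simp [hF])
    have hnrF := not_reach hac hc.symm
    have hle : F ≤ T := deleteEdges_le _
    -- distances on the far side
    have e3 : ∑ b ∈ Finset.univ.filter (fun b => ¬ F.Reachable c b), T.dist c b ≤
        ∑ b ∈ Finset.univ.filter (fun b => ¬ F.Reachable c b), T.dist w b := by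
      refine Finset.sum_le_sum fun b hb => ?_
      have hb' : ¬ F.Reachable c b := by simpa using hb
      have hbd : F.Reachable b (d j) := by
        rcases reach_or hTT.connected (x := d j) (p := c) b with h | h
        · exact h.symm
        · exact absurd h hb'
      rw [dist_comm (u := c), dist_comm (u := w),
        cross_dist_eq hac hle hc.symm hnrF hbd hreach,
        cross_dist_eq hac hle hc.symm hnrF hbd (Reachable.refl c)]
      simp
    have t1 := Finset.sum_erase_add Finset.univ (fun b => T.dist w b) (Finset.mem_univ v)
    have t2 := Finset.sum_erase_add Finset.univ (fun b => T.dist c b) (Finset.mem_univ v)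
    have t3 := Finset.sum_filter_add_sum_filter_not Finset.univ (fun b => F.Reachable c b)
      (fun b => T.dist w b)
    have t4 := Finset.sum_filter_add_sum_filter_not Finset.univ (fun b => F.Reachable c b)
      (fun b => T.dist c b)
    have hwv : T.dist w v = 1 := dist_eq_one_iff_adj.2 hw
    have hcv2 : T.dist c v ≠ 0 := by
      rw [Ne, hTT.connected.dist_eq_zero_iff]; exact hcv
    have hcv3 : T.dist c v ≠ 1 := by
      rw [Ne, dist_eq_one_iff_adj]
      exact fun h => hwc (hvN c h.symm).symm
    omega
end

section
/- Let G be a finite connected simple graph and let T be a MAD tree of G. If c is a median vertex of T (i.e., c minimizes dist_T(v) := Σ_{u ∈ V(T)} dist_T(u,v) over all vertices v of T), then every path in T starting at c is an induced path in G. -/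
open SimpleGraph

/-- A walk through the edge `py` is at least as long as a detour through that edge. -/
lemma walk_edge_split {V : Type*} {T : SimpleGraph V} (hT : T.Connected) {p y : V} {u v : V}
    (w : T.Walk u v) (h : s(p, y) ∈ w.edges) :
    T.dist u p + 1 + T.dist y v ≤ w.length ∨ T.dist u y + 1 + T.dist p v ≤ w.length := by
  induction w with
  | nil => simp at h
  | @cons a b c hab q ih =>
    rw [Walk.edges_cons, List.mem_cons] at h
    have hq := dist_le q
    have h1 : T.dist a b = 1 := dist_eq_one_iff_adj.2 hab
    have hp := hT.dist_triangle (u := a) (v := b) (w := p)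
    have hy := hT.dist_triangle (u := a) (v := b) (w := y)
    rw [Walk.length_cons]
    rcases h with h | h
    · rw [Sym2.eq_iff] at h
      rcases h with ⟨rfl, rfl⟩ | ⟨rfl, rfl⟩
      · left; rw [dist_self]; omega
      · right; rw [dist_self]; omega
    · rcases ih h with h | h
      · left; omega
      · right; omega

/-- Distance to a fixed vertex is locally convex along paths in a tree. -/
lemma tree_local_convex {V : Type*} {T : SimpleGraph V} (hT : T.IsTree) (u : V) {q r s : V}
    (hqr : T.Adj q r) (hrs : T.Adj r s) (hne : q ≠ s) :
    2 * T.dist u r ≤ T.dist u q + T.dist u s := by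
  by_contra hcon
  have h1 := hT.dist_eq_dist_add_one_of_adj u hqr
  have h2 := hT.dist_eq_dist_add_one_of_adj u hrs
  obtain ⟨P, hP⟩ := hT.connected.exists_walk_length_eq_dist u q
  obtain ⟨Q, hQ⟩ := hT.connected.exists_walk_length_eq_dist u s
  have hP' : (P.concat hqr).IsPath :=
    Walk.isPath_of_length_eq_dist _ (by rw [Walk.length_concat]; omega)
  have hQ' : (Q.concat hrs.symm).IsPath :=
    Walk.isPath_of_length_eq_dist _ (by rw [Walk.length_concat]; omega)
  have he : P.concat hqr = Q.concat hrs.symm :=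
    congrArg Subtype.val (hT.isAcyclic.path_unique ⟨_, hP'⟩ ⟨_, hQ'⟩)
  have := congrArg Walk.penultimate he
  simp at this
  exact hne this

/-- Walks avoiding the edge `py` survive its deletion. -/
lemma dist_delete_le {V : Type*} {T T' : SimpleGraph V} {p y u v : V}
    (hle : T.deleteEdges {s(p, y)} ≤ T')
    (w : T.Walk u v) (h : s(p, y) ∉ w.edges) :
    T'.Reachable u v ∧ T'.dist u v ≤ w.length := by
  let w' := (w.toDeleteEdge s(p, y) h).mapLe hle
  refine ⟨⟨w'⟩, (dist_le w').trans (le_of_eq ?_)⟩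
  simp [w', Walk.toDeleteEdge, Walk.toDeleteEdges]

/-- Vertices on the same side of `py` keep their distance after deleting `py`. -/
lemma same_side {V : Type*} {T T' : SimpleGraph V} (hT : T.Connected) {p y u v : V}
    (hle : T.deleteEdges {s(p, y)} ≤ T')
    (hu : T.dist u p < T.dist u y) (hv : T.dist v p < T.dist v y) :
    T'.Reachable u v ∧ T'.dist u v ≤ T.dist u v := by
  obtain ⟨w, hw⟩ := hT.exists_walk_length_eq_dist u v
  rw [← hw]
  apply dist_delete_le hle
  intro h
  have h1 := hT.dist_triangle (u := u) (v := p) (w := v)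
  have c1 : T.dist y v = T.dist v y := dist_comm
  have c2 : T.dist p v = T.dist v p := dist_comm
  have := walk_edge_split hT w h
  omega

/-- Distances across the tree edge `py`. -/
lemma cross_side {V : Type*} {T : SimpleGraph V} (hT : T.IsTree) {p y a b : V}
    (hpy : T.Adj p y)
    (ha : T.dist a p < T.dist a y) (hb : T.dist b y < T.dist b p) :
    T.dist a b = T.dist a p + 1 + T.dist y b := by
  have hc := hT.connected
  have hbr : ¬ (T.deleteEdges {s(p, y)}).Reachable p y :=
    isAcyclic_iff_forall_adj_isBridge.1 hT.isAcyclic hpy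
  obtain ⟨w, hw⟩ := hc.exists_walk_length_eq_dist a b
  have h1 : T.dist p y = 1 := dist_eq_one_iff_adj.2 hpy
  have h1' : T.dist y p = 1 := dist_eq_one_iff_adj.2 hpy.symm
  have hmem : s(p, y) ∈ w.edges := by
    by_contra hn
    apply hbr
    have r1 := (same_side hc (le_refl (T.deleteEdges {s(p, y)})) (u := p) (v := a)
      (by rw [dist_self]; omega) ha).1
    have r2 := (dist_delete_le (le_refl (T.deleteEdges {s(p, y)})) w hn).1
    have r3 := (same_side hc (p := y) (y := p) (T' := T.deleteEdges {s(p, y)})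
      (by rw [Sym2.eq_swap]) (u := b) (v := y) hb (by rw [dist_self]; omega)).1
    exact (r1.trans r2).trans r3
  have t1 := hc.dist_triangle (u := a) (v := p) (w := b)
  have t2 := hc.dist_triangle (u := p) (v := y) (w := b)
  have c1 : T.dist y b = T.dist b y := dist_comm
  have c2 : T.dist p b = T.dist b p := dist_comm
  have := walk_edge_split hc w hmem
  omega

/-- The edge exchange strictly improves the Wiener index. -/
lemma exchange_s9 {V : Type*} [Fintype V] {G T : SimpleGraph V} (hT : IsMADTree G T) {x p y : V}
    (hpy : T.Adj p y) (hxy : G.Adj x y) (hxp : x ≠ p) (hx : T.dist x p < T.dist x y)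
    (hD : ∑ u : V, T.dist u x ≤ ∑ u : V, T.dist u p) : False := by
  classical
  obtain ⟨⟨hTG, hTt⟩, hmin⟩ := hT
  have hc := hTt.connected
  set T' := T.deleteEdges {s(p, y)} ⊔ edge x y with hT'
  have hle : T.deleteEdges {s(p, y)} ≤ T' := le_sup_left
  have hle' : T.deleteEdges {s(y, p)} ≤ T' := by rw [Sym2.eq_swap]; exact hle
  have hbr : ¬ (T.deleteEdges {s(p, y)}).Reachable p y :=
    isAcyclic_iff_forall_adj_isBridge.1 hTt.isAcyclic hpy
  have h1 : T.dist p y = 1 := dist_eq_one_iff_adj.2 hpy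
  have h1' : T.dist y p = 1 := dist_eq_one_iff_adj.2 hpy.symm
  have hp0 : T.dist p p < T.dist p y := by rw [dist_self]; omega
  have hy0 : T.dist y y < T.dist y p := by rw [dist_self]; omega
  have hxp0 := hc.pos_dist_of_ne hxp
  have hadj : T'.Adj x y := by
    right; rw [edge_adj]; exact ⟨Or.inl ⟨rfl, rfl⟩, hxy.ne⟩
  have hside : ∀ u, T.dist u p < T.dist u y ∨ T.dist u y < T.dist u p := fun u => by
    have := hTt.dist_ne_of_adj u hpy
    omega
  have hreach : ∀ u, T'.Reachable u y := fun u => by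
    rcases hside u with h | h
    · exact (same_side hc hle h hx).1.trans hadj.reachable
    · exact (same_side hc hle' h hy0).1
  have hconn : T'.Connected :=
    (connected_iff_exists_forall_reachable _).2 ⟨y, fun u => (hreach u).symm⟩
  have hacyc : T'.IsAcyclic := by
    apply IsAcyclic.sup_edge_of_not_reachable
    · intro h
      exact hbr (((same_side hc (le_refl _) hp0 hx).1).trans h)
    · exact hTt.isAcyclic.anti (deleteEdges_le _)
  have hspan : IsSpanningTree G T' := by
    refine ⟨sup_le ((deleteEdges_le _).trans hTG) ?_, hconn, hacyc⟩
    rw [edge_le_iff]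
    exact Or.inr hxy
  have hW := hmin T' hspan
  set A := Finset.univ.filter (fun u => T.dist u p < T.dist u y) with hA
  set B := Finset.univ.filter (fun u => ¬ T.dist u p < T.dist u y) with hB
  have mA : ∀ u ∈ A, T.dist u p < T.dist u y := fun u hu => (Finset.mem_filter.1 hu).2
  have mB : ∀ u ∈ B, T.dist u y < T.dist u p := fun u hu =>
    (hside u).resolve_left (Finset.mem_filter.1 hu).2
  have hyB : y ∈ B := by simp [hB]
  have split : ∀ f : V → ℕ, ∑ u : V, f u = ∑ u ∈ A, f u + ∑ u ∈ B, f u := fun f =>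
    (Finset.sum_filter_add_sum_filter_not _ _ _).symm
  have hAA : ∑ a ∈ A, ∑ b ∈ A, T'.dist a b ≤ ∑ a ∈ A, ∑ b ∈ A, T.dist a b :=
    Finset.sum_le_sum fun a ha => Finset.sum_le_sum fun b hb =>
      (same_side hc hle (mA a ha) (mA b hb)).2
  have hBB : ∑ a ∈ B, ∑ b ∈ B, T'.dist a b ≤ ∑ a ∈ B, ∑ b ∈ B, T.dist a b :=
    Finset.sum_le_sum fun a ha => Finset.sum_le_sum fun b hb =>
      (same_side hc hle' (mB a ha) (mB b hb)).2
  have hBlt : ∑ b ∈ B, T.dist b p < ∑ b ∈ B, T.dist b x := by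
    apply Finset.sum_lt_sum_of_nonempty ⟨y, hyB⟩
    intro b hb
    have e1 := cross_side hTt hpy hx (mB b hb)
    have e2 := cross_side hTt hpy hp0 (mB b hb)
    rw [dist_self] at e2
    rw [dist_comm (u := b) (v := p), dist_comm (u := b) (v := x)]
    omega
  have hAlt : ∑ a ∈ A, T.dist a x < ∑ a ∈ A, T.dist a p := by
    rw [split, split] at hD
    omega
  have hAB : ∑ a ∈ A, ∑ b ∈ B, T'.dist a b < ∑ a ∈ A, ∑ b ∈ B, T.dist a b := by
    have l : ∑ a ∈ A, ∑ b ∈ B, T'.dist a b ≤ ∑ a ∈ A, ∑ b ∈ B, (T.dist a x + (1 + T.dist y b)) := by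
      refine Finset.sum_le_sum fun a ha => Finset.sum_le_sum fun b hb => ?_
      have t1 := hconn.dist_triangle (u := a) (v := x) (w := b)
      have t2 := hconn.dist_triangle (u := x) (v := y) (w := b)
      have t3 : T'.dist x y = 1 := dist_eq_one_iff_adj.2 hadj
      have t4 := (same_side hc hle (mA a ha) hx).2
      have t5 := (same_side hc hle' hy0 (mB b hb)).2
      omega
    have r : ∑ a ∈ A, ∑ b ∈ B, T.dist a b = ∑ a ∈ A, ∑ b ∈ B, (T.dist a p + (1 + T.dist y b)) := by
      refine Finset.sum_congr rfl fun a ha => Finset.sum_congr rfl fun b hb => ?_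
      rw [cross_side hTt hpy (mA a ha) (mB b hb)]
      omega
    refine l.trans_lt ?_
    rw [r]
    simp only [Finset.sum_add_distrib, Finset.sum_const, smul_eq_mul, ← Finset.mul_sum]
    have hpos : 0 < B.card := Finset.card_pos.2 ⟨y, hyB⟩
    have := Nat.mul_lt_mul_of_pos_left hAlt hpos
    omega
  have sw : ∀ S : SimpleGraph V, ∑ a ∈ B, ∑ b ∈ A, S.dist a b = ∑ a ∈ A, ∑ b ∈ B, S.dist a b := by
    intro S
    rw [Finset.sum_comm]
    exact Finset.sum_congr rfl fun a _ => Finset.sum_congr rfl fun b _ => dist_comm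
  have tot : ∀ S : SimpleGraph V, ∑ u : V, ∑ v : V, S.dist u v =
      ∑ a ∈ A, ∑ b ∈ A, S.dist a b + 2 * ∑ a ∈ A, ∑ b ∈ B, S.dist a b +
      ∑ a ∈ B, ∑ b ∈ B, S.dist a b := by
    intro S
    simp only [split, Finset.sum_add_distrib, sw S]
    omega
  unfold wiener at hW
  rw [tot T, tot T'] at hW
  omega

/-- The ordered version: `x` comes before `y` on the path. -/
lemma ordered_case {V : Type*} [Fintype V] {G T : SimpleGraph V} (hT : IsMADTree G T) {c v : V}
    (hmedian : ∀ v : V, (∑ u : V, T.dist u c) ≤ (∑ u : V, T.dist u v))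
    (P : T.Walk c v) (hP : P.IsPath) (i j : ℕ) (hij : i < j) (hj : j ≤ P.length)
    (hG : G.Adj (P.getVert i) (P.getVert j)) : s(P.getVert i, P.getVert j) ∈ P.edges := by
  have hTt := hT.1.2
  by_cases hij1 : j = i + 1
  · subst hij1
    rw [Walk.mk_mem_edges_iff_exists]
    exact ⟨i, by omega, rfl⟩
  exfalso
  have hinj : ∀ a b, a ≤ P.length → b ≤ P.length → a ≠ b → P.getVert a ≠ P.getVert b :=
    fun a b ha hb hab h => hab (hP.getVert_injOn ha hb h)
  have conv : ∀ u k, k + 2 ≤ P.length →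
      2 * T.dist u (P.getVert (k + 1)) ≤ T.dist u (P.getVert k) + T.dist u (P.getVert (k + 2)) :=
    fun u k hk => tree_local_convex hTt u (P.adj_getVert_succ (by omega))
      (P.adj_getVert_succ (by omega)) (hinj _ _ (by omega) (by omega) (by omega))
  have hDc : ∀ k, k + 1 ≤ P.length →
      ∑ u : V, T.dist u (P.getVert k) ≤ ∑ u : V, T.dist u (P.getVert (k + 1)) := by
    intro k
    induction k with
    | zero => intro _; rw [Walk.getVert_zero]; exact hmedian _
    | succ k ih =>
      intro hk
      have h1 := ih (by omega)
      have h2 := Finset.sum_le_sum (s := Finset.univ) fun u _ => conv u k (by omega)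
      rw [← Finset.mul_sum, Finset.sum_add_distrib] at h2
      have h3 : k + 1 + 1 = k + 2 := rfl
      rw [h3]
      omega
  have hDm : ∀ m, i + m ≤ P.length →
      ∑ u : V, T.dist u (P.getVert i) ≤ ∑ u : V, T.dist u (P.getVert (i + m)) := by
    intro m
    induction m with
    | zero => intro _; exact le_rfl
    | succ m ih => intro hm; exact (ih (by omega)).trans (hDc (i + m) (by omega))
  have hdx : ∀ m, i + m + 1 ≤ P.length →
      T.dist (P.getVert i) (P.getVert (i + m)) < T.dist (P.getVert i) (P.getVert (i + m + 1)) := by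
    intro m
    induction m with
    | zero =>
      intro hm
      rw [Nat.add_zero, dist_self]
      exact hTt.connected.pos_dist_of_ne (hinj _ _ (by omega) (by omega) (by omega))
    | succ m ih =>
      intro hm
      have h1 := ih (by omega)
      have h2 := conv (P.getVert i) (i + m) (by omega)
      have h3 : i + (m + 1) + 1 = i + m + 2 := rfl
      have h4 : i + (m + 1) = i + m + 1 := rfl
      rw [h3, h4]
      omega
  obtain ⟨m, rfl⟩ : ∃ m, j = i + m + 1 := ⟨j - i - 1, by omega⟩
  exact exchange_s9 hT (P.adj_getVert_succ (by omega)) hG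
    (hinj _ _ (by omega) (by omega) (by omega)) (hdx m hj) (hDm m (by omega))

theorem stmt9 {V : Type*} [Fintype V] (G : SimpleGraph V) (hG : G.Connected)
    (T : SimpleGraph V) (hT : IsMADTree G T) (c : V)
    (hmedian : ∀ v : V, (∑ u : V, T.dist u c) ≤ (∑ u : V, T.dist u v)) :
    IsRoot G T c := by
  intro v P hP x hx y hy hxy
  obtain ⟨i, rfl, hi⟩ := Walk.mem_support_iff_exists_getVert.1 hx
  obtain ⟨j, rfl, hj⟩ := Walk.mem_support_iff_exists_getVert.1 hy
  rcases lt_trichotomy i j with h | h | h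
  · exact ordered_case hT hmedian P hP i j h hj hxy
  · subst h
    exact absurd rfl hxy.ne
  · rw [Sym2.eq_swap]
    exact ordered_case hT hmedian P hP j i h hi hxy.symm
end
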